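/- Let n, d be integers with 2 ≤ d ≤ n−1, and let G be a tree of order n with diameter d that is not a double broom. Then there exists an integer d' with 2 ≤ d' ≤ d and a double broom G* of order n with diameter d' such that J_min(G) < J_min(G*). -/

import Mathlib

open Finset
open scoped Classical

/-- The degree of vertex `v` in `G`. -/
noncomputable def gdeg {V : Type*} [Fintype V] (G : SimpleGraph V) (v : V) : ℕ :=
  (Finset.univ.filter fun u => G.Adj v u).card

/-- `ℓ(u,v;w) = (d(u,w) + d(v,w) - d(u,v))/2`. -/
noncomputable def ell {V : Type*} (G : SimpleGraph V) (u v w : V) : ℚ :=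
  ((G.dist u w : ℚ) + (G.dist v w : ℚ) - (G.dist u v : ℚ)) / 2

/-- The hitting time `H(u,w) = Σ_v ℓ(u,v;w)·deg(v)` (valid formula on trees). -/
noncomputable def hitTime {V : Type*} [Fintype V] (G : SimpleGraph V) (u w : V) : ℚ :=
  ∑ v, ell G u v w * (gdeg G v : ℚ)

/-- The joining time to `w`: `J(w) = Σ_u deg(u)·H(u,w)`. -/
noncomputable def joinTime {V : Type*} [Fintype V] (G : SimpleGraph V) (w : V) : ℚ :=
  ∑ u, (gdeg G u : ℚ) * hitTime G u w

/-- `J_min(G) = min_{w} J(w)` (junk value 0 on the empty graph). -/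
noncomputable def Jmin {V : Type*} [Fintype V] (G : SimpleGraph V) : ℚ :=
  if h : Nonempty V then
    haveI := h
    Finset.univ.inf' Finset.univ_nonempty (joinTime G)
  else 0

/-- The best meeting time `T_bestmeet(G) = J_min(G)/(2(n-1))`. -/
noncomputable def bestMeet {V : Type*} [Fintype V] (G : SimpleGraph V) : ℚ :=
  Jmin G / (2 * ((Fintype.card V : ℚ) - 1))

/-- The diameter of `G` : the maximum of `d(u,v)` over pairs of vertices. -/
noncomputable def gdiam {V : Type*} [Fintype V] (G : SimpleGraph V) : ℕ :=
  Finset.univ.sup fun p : V × V => G.dist p.1 p.2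

/-- The lever of order `n` and diameter `d` with fulcrum `v_k`: a path `v_0, …, v_d`
(on vertices `0, …, d`) together with `n - d - 1` pendant leaves (vertices `d+1, …, n-1`)
all adjacent to `v_k`. -/
def leverGraph (n d k : ℕ) : SimpleGraph (Fin n) :=
  SimpleGraph.fromRel fun i j =>
    (i.val + 1 = j.val ∧ j.val ≤ d) ∨ (i.val = k ∧ d < j.val)

/-- The balanced lever `L_{n,d}`: the lever with fulcrum `v_{⌊d/2⌋}`. -/
def balancedLever (n d : ℕ) : SimpleGraph (Fin n) :=
  leverGraph n d (d / 2)

/-- The double broom of order `n`, diameter `d`, with `a` extra pendant leaves adjacent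
to `v_1` and `n - d - 1 - a` extra pendant leaves adjacent to `v_{d-1}`.  The path
`v_0, …, v_d` sits on vertices `0, …, d`, the leaves at `v_1` are `d+1, …, d+a`, and the
leaves at `v_{d-1}` are `d+a+1, …, n-1`. -/
def doubleBroom (n d a : ℕ) : SimpleGraph (Fin n) :=
  SimpleGraph.fromRel fun i j =>
    (i.val + 1 = j.val ∧ j.val ≤ d) ∨
    (i.val = 1 ∧ d < j.val ∧ j.val ≤ d + a) ∨
    (i.val = d - 1 ∧ d + a < j.val)

/-- The balanced double broom `D_{n,d}`, with `⌊(n-d-1)/2⌋` leaves at `v_1`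
and `⌈(n-d-1)/2⌉` leaves at `v_{d-1}`. -/
def balancedDoubleBroom (n d : ℕ) : SimpleGraph (Fin n) :=
  doubleBroom n d ((n - d - 1) / 2)

/-- The broom `B_{n,d}`: a path `v_0, …, v_d` with `n - d - 1` pendant leaves adjacent to `v_1`. -/
def broomGraph (n d : ℕ) : SimpleGraph (Fin n) :=
  doubleBroom n d (n - d - 1)

/-- The star `S_n = K_{1,n-1}` with center `0`. -/
def starGraph (n : ℕ) : SimpleGraph (Fin n) :=
  SimpleGraph.fromRel fun i _ => i.val = 0

section RootedTrees

variable {V : Type*}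

/-- A rooted tree presented by its root, parent map and depth function. -/
structure IsRooted (G : SimpleGraph V) (c : V) (par : V → V) (dep : V → ℕ) : Prop where
  par_root : par c = c
  dep_root : dep c = 0
  dep_par : ∀ v, v ≠ c → dep v = dep (par v) + 1
  adj_iff : ∀ u v, G.Adj u v ↔ (u ≠ c ∧ par u = v) ∨ (v ≠ c ∧ par v = u)

/-- `v` is an ancestor of `u` (or `u` itself) for the parent map `par`. -/
def Anc (par : V → V) (v u : V) : Prop := ∃ k : ℕ, par^[k] u = v

lemma Anc.refl (par : V → V) (v : V) : Anc par v v := ⟨0, rfl⟩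

lemma Anc.trans {par : V → V} {a b c : V} (h : Anc par a b) (h' : Anc par b c) :
    Anc par a c := by
  obtain ⟨k, rfl⟩ := h
  obtain ⟨l, rfl⟩ := h'
  exact ⟨k + l, Function.iterate_add_apply par k l c⟩

lemma Anc.par_self (par : V → V) (v : V) : Anc par (par v) v := ⟨1, rfl⟩

lemma anc_iff {par : V → V} {v u : V} : Anc par v u ↔ v = u ∨ Anc par v (par u) := by
  constructor
  · rintro ⟨k, rfl⟩
    cases k with
    | zero => left; rfl
    | succ k => right; exact ⟨k, rfl⟩
  · rintro (rfl | h)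
    · exact Anc.refl _ _
    · exact h.trans (Anc.par_self par u)

/-- Indicator of the ancestor relation. -/
noncomputable def chi (par : V → V) (v u : V) : ℚ := if Anc par v u then 1 else 0

lemma chi_eq (par : V → V) (v u : V) : chi par v u = 0 ∨ chi par v u = 1 := by
  unfold chi; split_ifs <;> simp

/-- The number of descendants of `v`, including `v`. -/
noncomputable def sz [Fintype V] (par : V → V) (v : V) : ℕ :=
  (Finset.univ.filter fun u => Anc par v u).card

lemma sz_pos [Fintype V] (par : V → V) (v : V) : 1 ≤ sz par v :=
  Finset.card_pos.mpr ⟨v, by simp [Anc.refl]⟩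

lemma sz_mono [Fintype V] {par : V → V} {v u : V} (h : Anc par v u) : sz par u ≤ sz par v :=
  Finset.card_le_card fun w hw => by
    simp only [Finset.mem_filter, Finset.mem_univ, true_and] at hw ⊢
    exact h.trans hw

lemma sz_eq_sum [Fintype V] (par : V → V) (v : V) : (sz par v : ℚ) = ∑ u, chi par v u := by
  simp [sz, chi]

namespace IsRooted

variable {G : SimpleGraph V} {c : V} {par : V → V} {dep : V → ℕ}

lemma dep_eq_zero (h : IsRooted G c par dep) {v : V} : dep v = 0 ↔ v = c := by
  constructor
  · intro hv
    by_contra hne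
    have := h.dep_par v hne
    omega
  · rintro rfl
    exact h.dep_root

lemma dep_pos (h : IsRooted G c par dep) {v : V} (hv : v ≠ c) : 0 < dep v :=
  Nat.pos_of_ne_zero fun h0 => hv (h.dep_eq_zero.mp h0)

lemma dep_par_eq (h : IsRooted G c par dep) (v : V) : dep (par v) = dep v - 1 := by
  by_cases hv : v = c
  · subst hv
    rw [h.par_root, h.dep_root]
  · have := h.dep_par v hv
    omega

lemma dep_iterate (h : IsRooted G c par dep) (k : ℕ) (v : V) :
    dep (par^[k] v) = dep v - k := by
  induction k generalizing v with
  | zero => rfl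
  | succ k ih =>
    rw [Function.iterate_succ_apply, ih, h.dep_par_eq]
    omega

lemma anc_root (h : IsRooted G c par dep) (v : V) : Anc par c v :=
  ⟨dep v, h.dep_eq_zero.mp (by rw [h.dep_iterate]; omega)⟩

lemma anc_dep_le (h : IsRooted G c par dep) {v u : V} (ha : Anc par v u) : dep v ≤ dep u := by
  obtain ⟨k, rfl⟩ := ha
  rw [h.dep_iterate]
  omega

lemma anc_eq_of_dep_le (h : IsRooted G c par dep) {v u : V} (ha : Anc par v u)
    (hd : dep u ≤ dep v) : v = u := by
  rcases anc_iff.mp ha with rfl | h'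
  · rfl
  · have h1 := h.anc_dep_le h'
    have h2 := h.dep_par_eq u
    have h3 : dep u = 0 := by omega
    have h4 : dep v = 0 := by omega
    rw [h.dep_eq_zero.mp h3, h.dep_eq_zero.mp h4]

lemma anc_eq_iterate (h : IsRooted G c par dep) {v u : V} (ha : Anc par v u) :
    par^[dep u - dep v] u = v := by
  obtain ⟨k, rfl⟩ := ha
  rw [h.dep_iterate]
  rcases le_or_gt k (dep u) with hk | hk
  · congr 2
    omega
  · have h1 : par^[k] u = c := h.dep_eq_zero.mp (by rw [h.dep_iterate]; omega)
    rw [h1]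
    exact h.dep_eq_zero.mp (by rw [h.dep_iterate]; omega)

lemma anc_unique (h : IsRooted G c par dep) {v w u : V} (hv : Anc par v u) (hw : Anc par w u)
    (hd : dep v = dep w) : v = w := by
  rw [← h.anc_eq_iterate hv, ← h.anc_eq_iterate hw, hd]

lemma anc_chain (h : IsRooted G c par dep) {v w u : V} (hv : Anc par v u) (hw : Anc par w u)
    (hd : dep v ≤ dep w) : Anc par v w := by
  have h1 := h.anc_dep_le hw
  refine ⟨dep w - dep v, ?_⟩
  rw [← h.anc_eq_iterate hw, ← Function.iterate_add_apply, h.dep_iterate]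
  have : dep u - (dep u - dep w) - dep v + (dep u - dep w) = dep u - dep v := by omega
  rw [this, h.anc_eq_iterate hv]

lemma not_anc_par (h : IsRooted G c par dep) {u : V} (hu : u ≠ c) : ¬ Anc par u (par u) := by
  intro ha
  have h1 := h.anc_dep_le ha
  have h2 := h.dep_par u hu
  omega

lemma chi_par (h : IsRooted G c par dep) {u : V} (hu : u ≠ c) (v : V) :
    chi par v u = chi par v (par u) + if v = u then 1 else 0 := by
  unfold chi
  by_cases hv : v = u
  · subst hv
    simp [Anc.refl, h.not_anc_par hu]
  · rw [anc_iff (v := v) (u := u)]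
    simp [hv]

lemma chi_root_left (h : IsRooted G c par dep) (u : V) : chi par c u = 1 := by
  simp [chi, h.anc_root u]

lemma chi_root_right (h : IsRooted G c par dep) {v : V} (hv : v ≠ c) : chi par v c = 0 := by
  have : ¬ Anc par v c := fun ha =>
    hv (h.anc_eq_of_dep_le ha (by rw [h.dep_root]; omega))
  simp [chi, this]

lemma adj_par (h : IsRooted G c par dep) {u : V} (hu : u ≠ c) : G.Adj u (par u) :=
  (h.adj_iff _ _).mpr (Or.inl ⟨hu, rfl⟩)

lemma reachable_root (h : IsRooted G c par dep) (u : V) : G.Reachable u c := by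
  induction hk : dep u generalizing u with
  | zero => rw [h.dep_eq_zero.mp hk]
  | succ k ih =>
    have hu : u ≠ c := fun hc => by rw [hc, h.dep_root] at hk; omega
    exact (h.adj_par hu).reachable.trans (ih _ (by rw [h.dep_par_eq, hk]; rfl))

lemma connected (h : IsRooted G c par dep) : G.Connected :=
  have : Nonempty V := ⟨c⟩
  ⟨fun u v => (h.reachable_root u).trans (h.reachable_root v).symm⟩

variable [Fintype V]

lemma sz_lt_sz_par (h : IsRooted G c par dep) {v : V} (hv : v ≠ c) :
    sz par v < sz par (par v) := by
  refine Finset.card_lt_card (Finset.ssubset_iff_of_subset ?_ |>.mpr ⟨par v, ?_, ?_⟩)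
  · intro w hw
    simp only [Finset.mem_filter, Finset.mem_univ, true_and] at hw ⊢
    exact (Anc.par_self par v).trans hw
  · simp [Anc.refl]
  · simpa using h.not_anc_par hv

lemma sum_sq_chi_adj (h : IsRooted G c par dep) {u w : V} (ha : G.Adj u w) :
    ∑ v, (chi par v u - chi par v w) ^ 2 = 1 := by
  rcases (h.adj_iff u w).mp ha with ⟨hu, rfl⟩ | ⟨hw, rfl⟩
  · simp [h.chi_par hu]
  · simp [h.chi_par hw]

lemma sum_sq_chi_le_length (h : IsRooted G c par dep) {u w : V} (p : G.Walk u w) :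
    ∑ v, (chi par v u - chi par v w) ^ 2 ≤ (p.length : ℚ) := by
  induction p with
  | nil => simp
  | @cons u x w ha p ih =>
    have h1 : ∑ v, (chi par v u - chi par v w) ^ 2 ≤
        ∑ v, ((chi par v u - chi par v x) ^ 2 + (chi par v x - chi par v w) ^ 2) := by
      refine Finset.sum_le_sum fun v _ => ?_
      rcases chi_eq par v u with e1 | e1 <;> rcases chi_eq par v x with e2 | e2 <;>
        rcases chi_eq par v w with e3 | e3 <;> rw [e1, e2, e3] <;> norm_num
    rw [Finset.sum_add_distrib, h.sum_sq_chi_adj ha] at h1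
    rw [SimpleGraph.Walk.length_cons]
    push_cast
    linarith

lemma sum_sq_chi_par (h : IsRooted G c par dep) {u w : V} (hu : u ≠ c) (hw : ¬ Anc par u w) :
    ∑ v, (chi par v u - chi par v w) ^ 2 = ∑ v, (chi par v (par u) - chi par v w) ^ 2 + 1 := by
  have h0 : chi par u w = 0 := by simp [chi, hw]
  have h1 : chi par u (par u) = 0 := by simp [chi, h.not_anc_par hu]
  have : ∀ v, (chi par v u - chi par v w) ^ 2 =
      (chi par v (par u) - chi par v w) ^ 2 + if v = u then 1 else 0 := by
    intro v
    rw [h.chi_par hu]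
    split_ifs with hv
    · subst hv
      rw [h0, h1]
      norm_num
    · ring
  rw [Finset.sum_congr rfl fun v _ => this v, Finset.sum_add_distrib]
  simp

lemma dist_le_sum_sq_chi (h : IsRooted G c par dep) (u w : V) :
    (G.dist u w : ℚ) ≤ ∑ v, (chi par v u - chi par v w) ^ 2 := by
  induction hk : dep u + dep w using Nat.strong_induction_on generalizing u w with
  | _ k ih =>
    have key : ∀ u w : V, dep u + dep w = k → dep w ≤ dep u →
        (G.dist u w : ℚ) ≤ ∑ v, (chi par v u - chi par v w) ^ 2 := by
      intro u w hk hd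
      by_cases huw : u = w
      · subst huw
        simp
      · have ha : ¬ Anc par u w := fun ha => huw (h.anc_eq_of_dep_le ha hd)
        have hu : u ≠ c := fun hu => ha (hu ▸ h.anc_root w)
        rw [h.sum_sq_chi_par hu ha]
        have h1 := h.dep_par u hu
        have h2 := ih (dep (par u) + dep w) (by omega) (par u) w rfl
        have h3 : G.dist u w ≤ G.dist u (par u) + G.dist (par u) w :=
          h.connected.dist_triangle
        rw [SimpleGraph.dist_eq_one_iff_adj.mpr (h.adj_par hu)] at h3
        have h4 : (G.dist u w : ℚ) ≤ 1 + G.dist (par u) w := by exact_mod_cast h3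
        linarith
    rcases le_total (dep w) (dep u) with hd | hd
    · exact key u w hk hd
    · rw [SimpleGraph.dist_comm, Finset.sum_congr rfl fun v _ => sub_sq_comm _ _]
      exact key w u (by omega) hd

/-- The ancestor indicators embed the tree isometrically into a hypercube. -/
lemma dist_eq (h : IsRooted G c par dep) (u w : V) :
    (G.dist u w : ℚ) = ∑ v, (chi par v u - chi par v w) ^ 2 := by
  refine le_antisymm (h.dist_le_sum_sq_chi u w) ?_
  obtain ⟨p, hp⟩ := h.connected.exists_walk_length_eq_dist u w
  rw [← hp]
  exact h.sum_sq_chi_le_length p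

lemma ell_eq (h : IsRooted G c par dep) (u u' w : V) :
    ell G u u' w = ∑ v, (chi par v u - chi par v w) * (chi par v u' - chi par v w) := by
  unfold ell
  rw [h.dist_eq, h.dist_eq, h.dist_eq, ← Finset.sum_add_distrib, ← Finset.sum_sub_distrib,
    Finset.sum_div]
  exact Finset.sum_congr rfl fun v _ => by ring

lemma joinTime_eq (h : IsRooted G c par dep) (w : V) :
    joinTime G w = ∑ v, (∑ u, (gdeg G u : ℚ) * (chi par v u - chi par v w)) ^ 2 := by
  unfold joinTime hitTime
  simp_rw [h.ell_eq, sq, Finset.sum_mul_sum, Finset.sum_mul, Finset.mul_sum]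
  refine (Finset.sum_congr rfl fun u _ => Finset.sum_comm).trans ?_
  rw [Finset.sum_comm]
  refine Finset.sum_congr rfl fun v _ => Finset.sum_congr rfl fun u _ =>
    Finset.sum_congr rfl fun u' _ => ?_
  ring

lemma gdeg_eq (h : IsRooted G c par dep) (u : V) :
    (gdeg G u : ℚ) = (if u = c then 0 else 1) + ∑ w ∈ univ.erase c, if par w = u then 1 else 0 := by
  have h1 : (gdeg G u : ℚ) = ∑ w, if G.Adj u w then (1 : ℚ) else 0 := by simp [gdeg]
  have h2 : ∀ w, (if G.Adj u w then (1 : ℚ) else 0) =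
      (if u ≠ c ∧ par u = w then 1 else 0) + (if w ≠ c ∧ par w = u then 1 else 0) := by
    intro w
    rw [h.adj_iff]
    by_cases hA : u ≠ c ∧ par u = w <;> by_cases hB : w ≠ c ∧ par w = u
    · exfalso
      have e1 := h.dep_par u hA.1
      have e2 := h.dep_par w hB.1
      rw [hA.2] at e1
      rw [hB.2] at e2
      omega
    · simp [hA, hB]
    · simp [hA, hB]
    · simp [hA, hB]
  rw [h1, Finset.sum_congr rfl fun w _ => h2 w, Finset.sum_add_distrib]
  congr 1
  · by_cases hu : u = c <;> simp [hu]
  · rw [← Finset.sum_erase (s := univ) (a := c) (by simp)]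
    refine Finset.sum_congr rfl fun w hw => ?_
    simp [Finset.ne_of_mem_erase hw]

lemma sum_gdeg_mul_chi (h : IsRooted G c par dep) (v : V) :
    ∑ u, (gdeg G u : ℚ) * chi par v u =
      2 * ∑ u ∈ univ.erase c, chi par v u - if v = c then 0 else 1 := by
  simp_rw [h.gdeg_eq, add_mul, Finset.sum_add_distrib, Finset.sum_mul]
  rw [Finset.sum_comm]
  have h1 : ∑ u, (if u = c then (0 : ℚ) else 1) * chi par v u = ∑ u ∈ univ.erase c, chi par v u := by
    rw [← Finset.sum_erase (s := univ) (a := c) (by simp)]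
    refine Finset.sum_congr rfl fun w hw => ?_
    simp [Finset.ne_of_mem_erase hw]
  have h2 : ∑ w ∈ univ.erase c, ∑ u, (if par w = u then (1 : ℚ) else 0) * chi par v u =
      ∑ w ∈ univ.erase c, (chi par v w - if v = w then 1 else 0) := by
    refine Finset.sum_congr rfl fun w hw => ?_
    rw [h.chi_par (Finset.ne_of_mem_erase hw)]
    simp
  rw [h1, h2, Finset.sum_sub_distrib]
  have h3 : ∑ w ∈ univ.erase c, (if v = w then (1 : ℚ) else 0) = if v = c then 0 else 1 := by
    by_cases hv : v = c <;> simp [hv]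
  rw [h3]
  ring

lemma sum_gdeg_mul_chi_of_ne (h : IsRooted G c par dep) {v : V} (hv : v ≠ c) :
    ∑ u, (gdeg G u : ℚ) * chi par v u = 2 * sz par v - 1 := by
  rw [h.sum_gdeg_mul_chi, Finset.sum_erase _ (h.chi_root_right hv), ← sz_eq_sum, if_neg hv]

lemma sum_gdeg (h : IsRooted G c par dep) :
    ∑ u, (gdeg G u : ℚ) = 2 * ((Fintype.card V : ℚ) - 1) := by
  have h1 := h.sum_gdeg_mul_chi c
  simp only [h.chi_root_left, if_true, mul_one, sub_zero] at h1
  rw [h1]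
  have h2 : 1 ≤ Fintype.card V := Fintype.card_pos_iff.mpr ⟨c⟩
  simp [Finset.card_erase_of_mem, Finset.card_univ, Nat.cast_sub h2]

/-- The joining time as a sum over edges of squared degree sums. -/
lemma joinTime_eq_sum (h : IsRooted G c par dep) (w : V) :
    joinTime G w = ∑ v ∈ univ.erase c,
      if Anc par v w then (2 * ((Fintype.card V : ℚ) - sz par v) - 1) ^ 2
      else (2 * (sz par v : ℚ) - 1) ^ 2 := by
  rw [h.joinTime_eq, ← Finset.sum_erase (s := univ) (a := c)]
  · refine Finset.sum_congr rfl fun v hv => ?_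
    have e : ∑ u, (gdeg G u : ℚ) * (chi par v u - chi par v w) =
        (2 * sz par v - 1) - 2 * ((Fintype.card V : ℚ) - 1) * chi par v w := by
      simp_rw [mul_sub]
      rw [Finset.sum_sub_distrib, h.sum_gdeg_mul_chi_of_ne (Finset.ne_of_mem_erase hv),
        ← Finset.sum_mul, h.sum_gdeg]
      ring
    rw [e]
    unfold chi
    split_ifs <;> ring
  · simp [h.chi_root_left]

lemma joinTime_root (h : IsRooted G c par dep) :
    joinTime G c = ∑ v ∈ univ.erase c, (2 * (sz par v : ℚ) - 1) ^ 2 := by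
  rw [h.joinTime_eq_sum]
  refine Finset.sum_congr rfl fun v hv => if_neg fun ha => ?_
  exact Finset.ne_of_mem_erase hv (h.anc_eq_of_dep_le ha (by rw [h.dep_root]; omega))

end IsRooted

end RootedTrees

section Centroid

variable {V : Type*} {G : SimpleGraph V}

/-- A tree rooted at any vertex is presented by its distance function. -/
lemma exists_isRooted (hT : G.IsTree) (c : V) : ∃ par : V → V, IsRooted G c par (G.dist c) := by
  have hconn := hT.connected
  have hex : ∀ v, ∃ p, (v = c → p = c) ∧ (v ≠ c → G.Adj p v ∧ G.dist c v = G.dist c p + 1) := by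
    intro v
    by_cases hv : v = c
    · exact ⟨c, fun _ => rfl, fun h => absurd hv h⟩
    · obtain ⟨p, hp⟩ := hconn.exists_walk_length_eq_dist c v
      have hnil : ¬ p.Nil := fun hn => hv hn.eq.symm
      refine ⟨p.penultimate, fun h => absurd h hv, fun _ => ⟨p.adj_penultimate hnil, ?_⟩⟩
      have h1 : G.dist c p.penultimate ≤ p.dropLast.length := SimpleGraph.dist_le _
      have h2 := SimpleGraph.Walk.length_dropLast_add_one hnil
      have h3 : G.dist c v ≤ G.dist c p.penultimate + G.dist p.penultimate v :=
        hconn.dist_triangle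
      rw [SimpleGraph.dist_eq_one_iff_adj.mpr (p.adj_penultimate hnil)] at h3
      omega
  choose par hpc hpar using hex
  have huniq : ∀ v x y, G.Adj x v → G.Adj y v → G.dist c v = G.dist c x + 1 →
      G.dist c v = G.dist c y + 1 → x = y := by
    intro v x y hx hy hdx hdy
    obtain ⟨p, hp⟩ := hconn.exists_walk_length_eq_dist c x
    obtain ⟨q, hq⟩ := hconn.exists_walk_length_eq_dist c y
    have h1 : (p.concat hx).IsPath :=
      SimpleGraph.Walk.isPath_of_length_eq_dist _ (by rw [SimpleGraph.Walk.length_concat, hp, hdx])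
    have h2 : (q.concat hy).IsPath :=
      SimpleGraph.Walk.isPath_of_length_eq_dist _ (by rw [SimpleGraph.Walk.length_concat, hq, hdy])
    have h3 := congrArg (fun r : G.Path c v => r.1.penultimate)
      ((hT.isAcyclic.subsingleton_path c v).elim ⟨_, h1⟩ ⟨_, h2⟩)
    simpa using h3
  refine ⟨par, hpc c rfl, SimpleGraph.dist_self, fun v hv => (hpar v hv).2, fun u v => ?_⟩
  constructor
  · intro ha
    rcases hT.dist_eq_dist_add_one_of_adj c ha with hd | hd
    · have hu : u ≠ c := by
        rintro rfl
        simp at hd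
      exact Or.inl ⟨hu, huniq u _ _ (hpar u hu).1 ha.symm (hpar u hu).2 hd⟩
    · have hv : v ≠ c := by
        rintro rfl
        simp at hd
      exact Or.inr ⟨hv, huniq v _ _ (hpar v hv).1 ha (hpar v hv).2 hd⟩
  · rintro (⟨hu, rfl⟩ | ⟨hv, rfl⟩)
    · exact (hpar u hu).1.symm
    · exact (hpar v hv).1

variable [Fintype V]

lemma Jmin_le (w : V) : Jmin G ≤ joinTime G w := by
  unfold Jmin
  rw [dif_pos ⟨w⟩]
  exact Finset.inf'_le _ (Finset.mem_univ w)

lemma exists_joinTime_eq_Jmin [Nonempty V] : ∃ c, joinTime G c = Jmin G := by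
  unfold Jmin
  rw [dif_pos ‹_›]
  obtain ⟨c, -, hc⟩ := Finset.exists_mem_eq_inf' (Finset.univ_nonempty (α := V)) (joinTime G)
  exact ⟨c, hc.symm⟩

namespace IsRooted

variable {c : V} {par : V → V} {dep : V → ℕ}

/-- Subtrees hanging from a vertex minimizing the joining time have at most half the vertices. -/
lemma two_mul_sz_le (h : IsRooted G c par dep) (hmin : ∀ w, joinTime G c ≤ joinTime G w) {v : V}
    (hv : v ≠ c) : 2 * sz par v ≤ Fintype.card V := by
  induction hk : dep v generalizing v with
  | zero => exact absurd (h.dep_eq_zero.mp hk) hv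
  | succ k ih =>
    by_cases hp : par v = c
    · have h1 := hmin v
      rw [h.joinTime_root, h.joinTime_eq_sum] at h1
      have hm : v ∈ univ.erase c := by simp [hv]
      rw [← Finset.add_sum_erase _ _ hm, ← Finset.add_sum_erase _ _ hm, if_pos (Anc.refl _ _)] at h1
      have h2 : ∀ x ∈ (univ.erase c).erase v,
          (if Anc par x v then (2 * ((Fintype.card V : ℚ) - sz par x) - 1) ^ 2
            else (2 * (sz par x : ℚ) - 1) ^ 2) = (2 * (sz par x : ℚ) - 1) ^ 2 := by
        intro x hx
        simp only [Finset.mem_erase, Finset.mem_univ, and_true] at hx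
        refine if_neg fun ha => ?_
        rcases anc_iff.mp ha with rfl | ha'
        · exact hx.1 rfl
        · rw [hp] at ha'
          exact hx.2 (h.anc_eq_of_dep_le ha' (by rw [h.dep_root]; omega))
      rw [Finset.sum_congr rfl h2] at h1
      have h3 : 1 ≤ sz par v := sz_pos par v
      have h4 : sz par v < Fintype.card V :=
        Finset.card_lt_univ_of_notMem (x := c) (by
          simp only [Finset.mem_filter, Finset.mem_univ, true_and]
          exact fun ha => hv (h.anc_eq_of_dep_le ha (by rw [h.dep_root]; omega)))
      by_contra hlt
      push Not at hlt
      have h5 : (1 : ℚ) ≤ sz par v := by exact_mod_cast h3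
      have h6 : (sz par v : ℚ) + 1 ≤ Fintype.card V := by exact_mod_cast h4
      have h7 : (Fintype.card V : ℚ) + 1 ≤ 2 * sz par v := by exact_mod_cast hlt
      nlinarith
    · exact (Nat.mul_le_mul_left 2 (sz_mono (Anc.par_self par v))).trans
        (ih hp (by rw [h.dep_par_eq, hk]; rfl))

/-- Lower bound for `Jmin` from lower bounds on the subtree sizes at a centroid. -/
lemma sum_le_Jmin (h : IsRooted G c par dep) (t : V → ℕ) (ht1 : ∀ v, 1 ≤ t v)
    (hts : ∀ v, v ≠ c → t v ≤ sz par v) (hs : ∀ v, v ≠ c → 2 * sz par v ≤ Fintype.card V) :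
    ∑ v ∈ univ.erase c, (2 * (t v : ℚ) - 1) ^ 2 ≤ Jmin G := by
  have : Nonempty V := ⟨c⟩
  obtain ⟨w, hw⟩ := exists_joinTime_eq_Jmin (G := G)
  rw [← hw, h.joinTime_eq_sum]
  refine Finset.sum_le_sum fun v hv => ?_
  have hne := Finset.ne_of_mem_erase hv
  have h1 : (1 : ℚ) ≤ t v := by exact_mod_cast ht1 v
  have h2 : (t v : ℚ) ≤ sz par v := by exact_mod_cast hts v hne
  have h3 : 2 * (sz par v : ℚ) ≤ Fintype.card V := by exact_mod_cast hs v hne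
  split_ifs <;> nlinarith

end IsRooted

end Centroid

section Convexity

variable {ι : Type*}

lemma sum_sq_le_of_sum (A : Finset ι) (s : ι → ℕ) (hs : ∀ v ∈ A, 1 ≤ s v) :
    ∑ v ∈ A, (2 * (s v : ℚ) - 1) ^ 2 ≤ (2 * ((∑ v ∈ A, s v : ℕ) : ℚ) - 1) ^ 2 ∧
      (2 ≤ A.card → ∑ v ∈ A, (2 * (s v : ℚ) - 1) ^ 2 <
        (2 * ((∑ v ∈ A, s v : ℕ) : ℚ) - 1) ^ 2) := by
  induction A using Finset.induction_on with
  | empty => simp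
  | insert a A ha ih =>
    have ih' := (ih fun v hv => hs v (Finset.mem_insert_of_mem hv)).1
    have ha1 : (1 : ℚ) ≤ s a := by exact_mod_cast hs a (Finset.mem_insert_self a A)
    rcases A.eq_empty_or_nonempty with rfl | ⟨b, hb⟩
    · simp
    · have h1 : 1 ≤ ∑ v ∈ A, s v :=
        (hs b (Finset.mem_insert_of_mem hb)).trans (Finset.single_le_sum (by simp) hb)
      have h2 : (1 : ℚ) ≤ ((∑ v ∈ A, s v : ℕ) : ℚ) := by exact_mod_cast h1
      rw [Finset.sum_insert ha, Finset.sum_insert ha]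
      rw [Nat.cast_add]
      generalize ((∑ v ∈ A, s v : ℕ) : ℚ) = r at *
      constructor
      · nlinarith
      · intro _
        nlinarith

lemma sum_sq_le_two (A : Finset ι) (s : ι → ℕ) (K L : ℕ) (hL : 1 ≤ L) (hLK : L ≤ K)
    (hs : ∀ v ∈ A, 1 ≤ s v) (hK : ∀ v ∈ A, s v ≤ K) (hsum : ∑ v ∈ A, s v ≤ K + L) :
    ∑ v ∈ A, (2 * (s v : ℚ) - 1) ^ 2 ≤ (2 * (K : ℚ) - 1) ^ 2 + (2 * (L : ℚ) - 1) ^ 2 ∧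
      (3 ≤ A.card → ∑ v ∈ A, (2 * (s v : ℚ) - 1) ^ 2 <
        (2 * (K : ℚ) - 1) ^ 2 + (2 * (L : ℚ) - 1) ^ 2) := by
  have hL' : (1 : ℚ) ≤ L := by exact_mod_cast hL
  have hLK' : (L : ℚ) ≤ K := by exact_mod_cast hLK
  by_cases hbig : ∃ a ∈ A, L < s a
  · obtain ⟨a, ha, haL⟩ := hbig
    obtain ⟨h1, h1'⟩ := sum_sq_le_of_sum (A.erase a) s fun v hv => hs v (Finset.mem_of_mem_erase hv)
    rw [← Finset.add_sum_erase _ _ ha] at hsum ⊢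
    have h2 : (s a : ℚ) ≤ K := by exact_mod_cast hK a ha
    have h3 : (L : ℚ) < s a := by exact_mod_cast haL
    have h4 : (s a : ℚ) + ((∑ v ∈ A.erase a, s v : ℕ) : ℚ) ≤ K + L := by exact_mod_cast hsum
    have h5 : ((∑ v ∈ A.erase a, s v : ℕ) : ℚ) = 0 ∨
        1 ≤ ((∑ v ∈ A.erase a, s v : ℕ) : ℚ) := by
      rcases Nat.eq_zero_or_pos (∑ v ∈ A.erase a, s v) with h0 | h0
      · left
        exact_mod_cast h0
      · right
        exact_mod_cast h0
    have h6 : (2 * (s a : ℚ) - 1) ^ 2 + (2 * ((∑ v ∈ A.erase a, s v : ℕ) : ℚ) - 1) ^ 2 ≤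
        (2 * (K : ℚ) - 1) ^ 2 + (2 * (L : ℚ) - 1) ^ 2 := by
      generalize ((∑ v ∈ A.erase a, s v : ℕ) : ℚ) = r at *
      rcases h5 with rfl | h5
      · nlinarith
      · nlinarith [mul_nonneg (sub_nonneg.mpr h2) (sub_nonneg.mpr h3.le)]
    refine ⟨by linarith, fun h7 => ?_⟩
    have := h1' (by rw [Finset.card_erase_of_mem ha]; omega)
    linarith
  · push Not at hbig
    have h1 : ∀ v ∈ A, (L : ℚ) * (2 * (s v : ℚ) - 1) ^ 2 ≤ s v * (2 * (L : ℚ) - 1) ^ 2 := by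
      intro v hv
      have e1 : (1 : ℚ) ≤ s v := by exact_mod_cast hs v hv
      have e2 : (s v : ℚ) ≤ L := by exact_mod_cast hbig v hv
      nlinarith [mul_nonneg (sub_nonneg.mpr e2) (show (0 : ℚ) ≤ 4 * s v * L - 1 by nlinarith)]
    have h2 := Finset.sum_le_sum h1
    rw [← Finset.mul_sum, ← Finset.sum_mul, ← Nat.cast_sum] at h2
    have h3 : ((∑ v ∈ A, s v : ℕ) : ℚ) ≤ K + L := by exact_mod_cast hsum
    have h4 : ((∑ v ∈ A, s v : ℕ) : ℚ) * (2 * (L : ℚ) - 1) ^ 2 ≤ (K + L) * (2 * (L : ℚ) - 1) ^ 2 :=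
      mul_le_mul_of_nonneg_right h3 (sq_nonneg _)
    have h5 : (L : ℚ) * (2 * (K : ℚ) - 1) ^ 2 - K * (2 * (L : ℚ) - 1) ^ 2 =
        (K - L) * (4 * K * L - 1) := by ring
    have h6 : (0 : ℚ) < 4 * K * L - 1 := by nlinarith
    have h7 : (0 : ℚ) ≤ (K - L) * (4 * K * L - 1) := mul_nonneg (by linarith) h6.le
    have hL0 : (0 : ℚ) < L := by linarith
    constructor
    · refine le_of_mul_le_mul_left ?_ hL0
      linarith
    · intro hcard
      refine lt_of_mul_lt_mul_left ?_ hL0.le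
      rcases hLK.lt_or_eq with hlt | rfl
      · have h8 : (0 : ℚ) < (K - L) * (4 * K * L - 1) :=
          mul_pos (sub_pos.mpr (by exact_mod_cast hlt)) h6
        linarith
      · by_cases hall : ∀ v ∈ A, s v = L
        · exfalso
          rw [Finset.sum_congr rfl hall, Finset.sum_const, smul_eq_mul] at hsum
          nlinarith
        · push Not at hall
          obtain ⟨v, hv, hne⟩ := hall
          have e0 : s v < L := lt_of_le_of_ne (hbig v hv) hne
          have e1 : (1 : ℚ) ≤ s v := by exact_mod_cast hs v hv
          have e2 : (s v : ℚ) < L := by exact_mod_cast e0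
          have h9 := Finset.sum_lt_sum h1 ⟨v, hv, by
            nlinarith [mul_pos (sub_pos.mpr e2) (show (0 : ℚ) < 4 * s v * L - 1 by nlinarith)]⟩
          rw [← Finset.mul_sum, ← Finset.sum_mul, ← Nat.cast_sum] at h9
          linarith

end Convexity

section Levels

variable {V : Type*} [Fintype V] {G : SimpleGraph V} {c : V} {par : V → V} {dep : V → ℕ}

/-- Subtrees of distinct vertices at the same depth are disjoint from each other and from
every set of shallower vertices. -/
lemma IsRooted.sum_sz_add_card_le (h : IsRooted G c par dep) {j : ℕ} (A C D : Finset V)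
    (hA : ∀ v ∈ A, dep v = j) (hC : ∀ v ∈ C, dep v < j) (hCD : C ⊆ D)
    (hAD : ∀ v ∈ A, ∀ u, Anc par v u → u ∈ D) :
    ∑ v ∈ A, sz par v + C.card ≤ D.card := by
  have h1 : (A.biUnion fun v => univ.filter fun u => Anc par v u).card = ∑ v ∈ A, sz par v := by
    refine Finset.card_biUnion fun v hv w hw hvw => Finset.disjoint_left.mpr fun u hu hu' => ?_
    simp only [Finset.mem_filter, Finset.mem_univ, true_and] at hu hu'
    exact hvw (h.anc_unique hu hu' ((hA v hv).trans (hA w hw).symm))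
  rw [← h1, ← Finset.card_union_of_disjoint]
  · refine Finset.card_le_card (Finset.union_subset (fun u hu => ?_) hCD)
    simp only [Finset.mem_biUnion, Finset.mem_filter, Finset.mem_univ, true_and] at hu
    obtain ⟨v, hv, hvu⟩ := hu
    exact hAD v hv u hvu
  · refine Finset.disjoint_left.mpr fun u hu hu' => ?_
    simp only [Finset.mem_biUnion, Finset.mem_filter, Finset.mem_univ, true_and] at hu
    obtain ⟨v, hv, hvu⟩ := hu
    have e1 := h.anc_dep_le hvu
    have e2 := hA v hv
    have e3 := hC u hu'
    omega

/-- Two chains `X`, `Y` descending from the root of a tree, `X` through its child `b` down to the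
maximal depth `h₁`, and `Y` avoiding `b` down to the maximal depth `h₂` of a vertex outside
the branch at `b`. -/
structure TwoChains (c : V) (par : V → V) (dep : V → ℕ) (b : V) (X Y : ℕ → V)
    (h₁ h₂ M₁ M₂ : ℕ) : Prop where
  dep_b : dep b = 1
  dep_X : ∀ i, i ≤ h₁ → dep (X i) = i
  anc_X : ∀ i, 1 ≤ i → i ≤ h₁ → Anc par b (X i)
  dep_Y : ∀ i, i ≤ h₂ → dep (Y i) = i
  not_anc_Y : ∀ i, i ≤ h₂ → ¬ Anc par b (Y i)
  dep_le : ∀ v, dep v ≤ h₁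
  dep_le_of_not_anc : ∀ v, ¬ Anc par b v → dep v ≤ h₂
  one_le : 1 ≤ h₂
  le : h₂ ≤ h₁
  sz_le : ∀ v, v ≠ c → sz par v ≤ M₁
  card_eq : M₁ + M₂ + 1 = Fintype.card V
  M_le : M₂ ≤ M₁
  h₁_le : h₁ ≤ M₁
  h₂_le : h₂ ≤ M₂

/-- The contribution of depth `j` to the joining time of a double broom. -/
noncomputable def levelBound (h₁ h₂ M₁ M₂ j : ℕ) : ℚ :=
  (if j < h₁ then (2 * ((M₁ + 1 - j : ℕ) : ℚ) - 1) ^ 2 else 0) +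
  (if j < h₂ then (2 * ((M₂ + 1 - j : ℕ) : ℚ) - 1) ^ 2 else 0) +
  (if j = h₁ then ((M₁ + 1 - j : ℕ) : ℚ) else 0) +
  (if j = h₂ then ((M₂ + 1 - j : ℕ) : ℚ) else 0)

/-- The vertices at depth `j`. -/
noncomputable def level (dep : V → ℕ) (j : ℕ) : Finset V := univ.filter fun v => dep v = j

/-- The vertices at depth `j` below `b`. -/
noncomputable def levelIn (par : V → V) (dep : V → ℕ) (b : V) (j : ℕ) : Finset V :=
  (level dep j).filter fun v => Anc par b v

namespace TwoChains

variable {b : V} {X Y : ℕ → V} {h₁ h₂ M₁ M₂ : ℕ}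

lemma sz_add_dep_le (t : TwoChains c par dep b X Y h₁ h₂ M₁ M₂) (h : IsRooted G c par dep)
    {v : V} (hv : v ≠ c) : sz par v + dep v ≤ M₁ + 1 := by
  induction hk : dep v generalizing v with
  | zero => exact absurd (h.dep_eq_zero.mp hk) hv
  | succ k ih =>
    by_cases hp : par v = c
    · have h1 := h.dep_par v hv
      rw [hp, h.dep_root] at h1
      have := t.sz_le v hv
      omega
    · have h1 := ih hp (by rw [h.dep_par_eq, hk]; rfl)
      have h2 := h.sz_lt_sz_par hv
      omega

lemma card_image_X (t : TwoChains c par dep b X Y h₁ h₂ M₁ M₂) {i j : ℕ} (hj : j ≤ h₁ + 1) :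
    ((Finset.Ico i j).image X).card = j - i := by
  rw [Finset.card_image_of_injOn, Nat.card_Ico]
  intro k hk l hl hkl
  simp only [Finset.coe_Ico, Set.mem_Ico] at hk hl
  have := congrArg dep hkl
  rwa [t.dep_X k (by omega), t.dep_X l (by omega)] at this

lemma card_image_Y (t : TwoChains c par dep b X Y h₁ h₂ M₁ M₂) {i j : ℕ} (hj : j ≤ h₂ + 1) :
    ((Finset.Ico i j).image Y).card = j - i := by
  rw [Finset.card_image_of_injOn, Nat.card_Ico]
  intro k hk l hl hkl
  simp only [Finset.coe_Ico, Set.mem_Ico] at hk hl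
  have := congrArg dep hkl
  rwa [t.dep_Y k (by omega), t.dep_Y l (by omega)] at this

lemma sum_sz_levelIn_le (t : TwoChains c par dep b X Y h₁ h₂ M₁ M₂) (h : IsRooted G c par dep)
    {j : ℕ} (hj1 : 1 ≤ j) (hj : j ≤ h₁) :
    ∑ v ∈ levelIn par dep b j, sz par v ≤ M₁ + 1 - j := by
  have hbc : b ≠ c := fun hb => by
    have := t.dep_b
    rw [hb, h.dep_root] at this
    omega
  have h1 := h.sum_sz_add_card_le (j := j) (levelIn par dep b j) ((Finset.Ico 1 j).image X)
    (univ.filter fun u => Anc par b u)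
    (fun v hv => by simpa [level] using (Finset.mem_filter.mp hv).1)
    (fun v hv => by
      obtain ⟨i, hi, rfl⟩ := Finset.mem_image.mp hv
      rw [Finset.mem_Ico] at hi
      rw [t.dep_X i (by omega)]
      exact hi.2)
    (fun v hv => by
      obtain ⟨i, hi, rfl⟩ := Finset.mem_image.mp hv
      rw [Finset.mem_Ico] at hi
      simpa using t.anc_X i hi.1 (by omega))
    (fun v hv u hu => by
      simpa using (Finset.mem_filter.mp hv).2.trans hu)
  rw [t.card_image_X (by omega)] at h1
  have h2 : sz par b ≤ M₁ := t.sz_le b hbc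
  unfold sz at h2 h1
  unfold sz
  omega

lemma sum_sz_level_le (t : TwoChains c par dep b X Y h₁ h₂ M₁ M₂) (h : IsRooted G c par dep)
    {j : ℕ} (hj1 : 1 ≤ j) (hj : j ≤ h₂) :
    ∑ v ∈ level dep j, sz par v ≤ (M₁ + 1 - j) + (M₂ + 1 - j) := by
  have hle := t.le
  have h1 := h.sum_sz_add_card_le (j := j) (level dep j)
    ((Finset.Ico 1 j).image X ∪ (Finset.Ico 0 j).image Y) univ
    (fun v hv => by simpa [level] using hv)
    (fun v hv => by
      rcases Finset.mem_union.mp hv with hv | hv <;> obtain ⟨i, hi, rfl⟩ := Finset.mem_image.mp hv <;>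
        rw [Finset.mem_Ico] at hi
      · rw [t.dep_X i (by omega)]
        exact hi.2
      · rw [t.dep_Y i (by omega)]
        exact hi.2)
    (Finset.subset_univ _) (fun _ _ _ _ => Finset.mem_univ _)
  rw [Finset.card_union_of_disjoint, t.card_image_X (by omega), t.card_image_Y (by omega),
    Finset.card_univ] at h1
  · have h2 := t.card_eq
    have h3 := t.h₂_le
    have h4 := t.M_le
    omega
  · refine Finset.disjoint_left.mpr fun v hv hv' => ?_
    obtain ⟨i, hi, rfl⟩ := Finset.mem_image.mp hv
    obtain ⟨k, hk, hki⟩ := Finset.mem_image.mp hv'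
    rw [Finset.mem_Ico] at hi hk
    exact t.not_anc_Y k (by omega) (hki ▸ t.anc_X i hi.1 (by omega))

lemma sum_level_eq (b : V) (par : V → V) (dep : V → ℕ) (j : ℕ) {M : Type*} [AddCommMonoid M]
    (f : V → M) :
    ∑ v ∈ level dep j, f v = ∑ v ∈ levelIn par dep b j, f v +
      ∑ v ∈ (level dep j).filter (fun v => ¬ Anc par b v), f v :=
  (Finset.sum_filter_add_sum_filter_not _ _ _).symm

lemma sz_eq_one (h : IsRooted G c par dep) {v : V} (hv : ∀ u, Anc par v u → dep u ≤ dep v) :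
    sz par v = 1 := by
  rw [sz, Finset.card_eq_one]
  refine ⟨v, Finset.ext fun u => ?_⟩
  simp only [Finset.mem_filter, Finset.mem_univ, true_and, Finset.mem_singleton]
  exact ⟨fun ha => (h.anc_eq_of_dep_le ha (hv u ha)).symm, fun e => e ▸ Anc.refl _ _⟩

lemma sum_level_le (t : TwoChains c par dep b X Y h₁ h₂ M₁ M₂) (h : IsRooted G c par dep)
    {j : ℕ} (hj1 : 1 ≤ j) (hj : j ≤ h₁) :
    ∑ v ∈ level dep j, (2 * (sz par v : ℚ) - 1) ^ 2 ≤ levelBound h₁ h₂ M₁ M₂ j ∧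
      (∑ v ∈ level dep j, (2 * (sz par v : ℚ) - 1) ^ 2 = levelBound h₁ h₂ M₁ M₂ j →
        (j < h₂ → (level dep j).card ≤ 2) ∧ (j < h₁ → h₂ ≤ j → (levelIn par dep b j).card ≤ 1)) := by
  have hle := t.le
  have hM := t.M_le
  have hh1 := t.h₁_le
  have hh2 := t.h₂_le
  have hroot : ∀ v ∈ level dep j, v ≠ c := by
    rintro v hv rfl
    simp only [level, Finset.mem_filter, Finset.mem_univ, true_and] at hv
    rw [h.dep_root] at hv
    omega
  have hdep : ∀ v ∈ level dep j, dep v = j := fun v hv => by simpa [level] using hv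
  rcases lt_or_ge j h₂ with hj2 | hj2
  · have hb : levelBound h₁ h₂ M₁ M₂ j =
        (2 * ((M₁ + 1 - j : ℕ) : ℚ) - 1) ^ 2 + (2 * ((M₂ + 1 - j : ℕ) : ℚ) - 1) ^ 2 := by
      unfold levelBound
      rw [if_pos (by omega), if_pos hj2, if_neg (by omega), if_neg (by omega)]
      ring
    obtain ⟨e1, e2⟩ := sum_sq_le_two (level dep j) (sz par) (M₁ + 1 - j) (M₂ + 1 - j) (by omega)
      (by omega) (fun v _ => sz_pos par v)
      (fun v hv => by
        have := t.sz_add_dep_le h (hroot v hv)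
        rw [hdep v hv] at this
        omega)
      (t.sum_sz_level_le h hj1 hj2.le)
    rw [hb]
    refine ⟨e1, fun he => ⟨fun _ => ?_, fun _ _ => by omega⟩⟩
    by_contra hcard
    exact absurd he (e2 (by omega)).ne
  · have hR1 : ∀ v ∈ (level dep j).filter (fun v => ¬ Anc par b v), sz par v = 1 := by
      intro v hv
      rw [Finset.mem_filter] at hv
      refine sz_eq_one h fun u hu => ?_
      have hnb : ¬ Anc par b u := fun hbu =>
        hv.2 (h.anc_chain hbu hu (by rw [t.dep_b, hdep v hv.1]; exact hj1))
      have := t.dep_le_of_not_anc u hnb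
      rw [hdep v hv.1]
      omega
    have hRsum : ∑ v ∈ (level dep j).filter (fun v => ¬ Anc par b v), (2 * (sz par v : ℚ) - 1) ^ 2 =
        ((∑ v ∈ (level dep j).filter (fun v => ¬ Anc par b v), sz par v : ℕ) : ℚ) := by
      rw [Nat.cast_sum]
      refine Finset.sum_congr rfl fun v hv => ?_
      rw [hR1 v hv]
      norm_num
    have hβ := t.sum_sz_levelIn_le h hj1 hj
    have hσ : ∑ v ∈ levelIn par dep b j, sz par v +
        ∑ v ∈ (level dep j).filter (fun v => ¬ Anc par b v), sz par v ≤
        (M₁ + 1 - j) + if j = h₂ then M₂ + 1 - j else 0 := by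
      rw [← sum_level_eq]
      split_ifs with hjh
      · exact t.sum_sz_level_le h hj1 hjh.le
      · rw [sum_level_eq b par]
        have : (level dep j).filter (fun v => ¬ Anc par b v) = ∅ := by
          refine Finset.filter_eq_empty_iff.mpr fun v hv hb => ?_
          have := t.dep_le_of_not_anc v hb
          rw [hdep v hv] at this
          omega
        rw [this, Finset.sum_empty]
        exact hβ
    rw [sum_level_eq b par, hRsum]
    generalize (∑ v ∈ (level dep j).filter (fun v => ¬ Anc par b v), sz par v) = r at *
    rcases hj.lt_or_eq with hlt | heq
    · have hb : levelBound h₁ h₂ M₁ M₂ j = (2 * ((M₁ + 1 - j : ℕ) : ℚ) - 1) ^ 2 +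
          ((if j = h₂ then M₂ + 1 - j else 0 : ℕ) : ℚ) := by
        unfold levelBound
        rw [if_pos hlt, if_neg (by omega), if_neg (by omega)]
        push_cast
        ring
      rw [hb]
      obtain ⟨e1, e2⟩ := sum_sq_le_of_sum (levelIn par dep b j) (sz par) fun v _ => sz_pos par v
      have hXB : X j ∈ levelIn par dep b j := by
        simp only [levelIn, level, Finset.mem_filter, Finset.mem_univ, true_and]
        exact ⟨t.dep_X j hj, t.anc_X j hj1 hj⟩
      have hβ1 : 1 ≤ ∑ v ∈ levelIn par dep b j, sz par v :=
        (sz_pos par (X j)).trans (Finset.single_le_sum (by simp) hXB)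
      generalize (if j = h₂ then M₂ + 1 - j else 0) = L at *
      generalize (∑ v ∈ levelIn par dep b j, sz par v) = β at *
      generalize M₁ + 1 - j = K at *
      have q1 : (1 : ℚ) ≤ β := by exact_mod_cast hβ1
      have q2 : (β : ℚ) ≤ K := by exact_mod_cast hβ
      have q3 : (β : ℚ) + r ≤ K + L := by exact_mod_cast hσ
      have q4 : (2 * (β : ℚ) - 1) ^ 2 + r ≤ (2 * (K : ℚ) - 1) ^ 2 + L := by nlinarith
      refine ⟨by linarith, fun he => ⟨fun _ => by omega, fun _ _ => ?_⟩⟩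
      by_contra hcard
      have := e2 (by omega)
      linarith
    · have hb : levelBound h₁ h₂ M₁ M₂ j =
          (((M₁ + 1 - j) + if j = h₂ then M₂ + 1 - j else 0 : ℕ) : ℚ) := by
        unfold levelBound
        rw [if_neg (by omega), if_neg (by omega), if_pos heq]
        push_cast
        ring
      rw [hb]
      have hB1 : ∑ v ∈ levelIn par dep b j, (2 * (sz par v : ℚ) - 1) ^ 2 =
          ((∑ v ∈ levelIn par dep b j, sz par v : ℕ) : ℚ) := by
        rw [Nat.cast_sum]
        refine Finset.sum_congr rfl fun v hv => ?_
        rw [sz_eq_one h fun u _ => by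
          rw [hdep v (Finset.mem_filter.mp hv).1, heq]
          exact t.dep_le u]
        norm_num
      rw [hB1]
      exact ⟨by exact_mod_cast hσ, fun _ => ⟨fun _ => by omega, fun _ _ => by omega⟩⟩

lemma joinTime_eq_sum_level (t : TwoChains c par dep b X Y h₁ h₂ M₁ M₂)
    (h : IsRooted G c par dep) :
    joinTime G c = ∑ j ∈ Finset.Icc 1 h₁, ∑ v ∈ level dep j, (2 * (sz par v : ℚ) - 1) ^ 2 := by
  rw [h.joinTime_root, ← Finset.sum_fiberwise_of_maps_to (g := dep) (t := Finset.Icc 1 h₁)]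
  · refine Finset.sum_congr rfl fun j hj => Finset.sum_congr (Finset.ext fun v => ?_) fun _ _ => rfl
    simp only [level, Finset.mem_filter, Finset.mem_erase, Finset.mem_univ, and_true, true_and,
      and_iff_right_iff_imp]
    rintro rfl rfl
    rw [h.dep_root, Finset.mem_Icc] at hj
    omega
  · intro v hv
    exact Finset.mem_Icc.mpr ⟨h.dep_pos (Finset.ne_of_mem_erase hv), t.dep_le v⟩

lemma joinTime_le (t : TwoChains c par dep b X Y h₁ h₂ M₁ M₂) (h : IsRooted G c par dep) :
    joinTime G c ≤ ∑ j ∈ Finset.Icc 1 h₁, levelBound h₁ h₂ M₁ M₂ j := by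
  rw [t.joinTime_eq_sum_level h]
  refine Finset.sum_le_sum fun j hj => ?_
  rw [Finset.mem_Icc] at hj
  exact (t.sum_level_le h hj.1 hj.2).1

/-- In the extremal case every vertex is on one of the chains or hangs from the penultimate
vertex of a chain. -/
lemma structure_of_joinTime_eq (t : TwoChains c par dep b X Y h₁ h₂ M₁ M₂)
    (h : IsRooted G c par dep)
    (he : joinTime G c = ∑ j ∈ Finset.Icc 1 h₁, levelBound h₁ h₂ M₁ M₂ j) (u : V) :
    (∃ i, i ≤ h₁ ∧ u = X i) ∨ (∃ i, i ≤ h₂ ∧ u = Y i) ∨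
      (u ≠ c ∧ (par u = X (h₁ - 1) ∨ par u = Y (h₂ - 1))) := by
  have hle := t.le
  have h2pos := t.one_le
  rw [t.joinTime_eq_sum_level h] at he
  have hlev := (Finset.sum_eq_sum_iff_of_le fun j hj => by
    rw [Finset.mem_Icc] at hj
    exact (t.sum_level_le h hj.1 hj.2).1).mp he
  have hroot0 : ∀ v, dep v = 0 → v = X 0 := fun v hv => by
    rw [h.dep_eq_zero.mp hv, h.dep_eq_zero.mp (t.dep_X 0 (by omega))]
  have hrootY : ∀ v, dep v = 0 → v = Y 0 := fun v hv => by
    rw [h.dep_eq_zero.mp hv, h.dep_eq_zero.mp (t.dep_Y 0 (by omega))]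
  have hin : ∀ v, Anc par b v → dep v < h₁ → v = X (dep v) := by
    intro v hbv hv
    have h1 : 1 ≤ dep v := t.dep_b ▸ h.anc_dep_le hbv
    obtain ⟨e1, e2⟩ := (t.sum_level_le h h1 hv.le).2 (hlev _ (Finset.mem_Icc.mpr ⟨h1, hv.le⟩))
    rcases lt_or_ge (dep v) h₂ with h2 | h2
    · by_contra hne
      have e3 : ({v, X (dep v), Y (dep v)} : Finset V) ⊆ level dep (dep v) := by
        intro w hw
        simp only [Finset.mem_insert, Finset.mem_singleton] at hw
        simp only [level, Finset.mem_filter, Finset.mem_univ, true_and]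
        rcases hw with rfl | rfl | rfl
        · rfl
        · exact t.dep_X _ hv.le
        · exact t.dep_Y _ h2.le
      have e4 : ({v, X (dep v), Y (dep v)} : Finset V).card = 3 := by
        refine Finset.card_eq_three.mpr ⟨_, _, _, hne, ?_, ?_, rfl⟩
        · exact fun e => t.not_anc_Y _ h2.le (e ▸ hbv)
        · exact fun e => t.not_anc_Y _ h2.le (e ▸ t.anc_X _ h1 hv.le)
      have := Finset.card_le_card e3
      have := e1 h2
      omega
    · refine Finset.card_le_one.mp (e2 hv h2) v ?_ _ ?_
      · simp [levelIn, level, hbv]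
      · simp only [levelIn, level, Finset.mem_filter, Finset.mem_univ, true_and]
        exact ⟨t.dep_X _ hv.le, t.anc_X _ h1 hv.le⟩
  have hout : ∀ v, ¬ Anc par b v → dep v < h₂ → v = Y (dep v) := by
    intro v hbv hv
    rcases Nat.eq_zero_or_pos (dep v) with h0 | h1
    · rw [h0]
      exact hrootY v h0
    · obtain ⟨e1, -⟩ := (t.sum_level_le h h1 (by omega)).2
        (hlev _ (Finset.mem_Icc.mpr ⟨h1, by omega⟩))
      by_contra hne
      have e3 : ({v, X (dep v), Y (dep v)} : Finset V) ⊆ level dep (dep v) := by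
        intro w hw
        simp only [Finset.mem_insert, Finset.mem_singleton] at hw
        simp only [level, Finset.mem_filter, Finset.mem_univ, true_and]
        rcases hw with rfl | rfl | rfl
        · rfl
        · exact t.dep_X _ (by omega)
        · exact t.dep_Y _ hv.le
      have e4 : ({v, X (dep v), Y (dep v)} : Finset V).card = 3 := by
        refine Finset.card_eq_three.mpr ⟨_, _, _, ?_, hne, ?_, rfl⟩
        · exact fun e => hbv (e ▸ t.anc_X _ h1 (by omega))
        · exact fun e => t.not_anc_Y _ hv.le (e ▸ t.anc_X _ h1 (by omega))
      have := Finset.card_le_card e3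
      have := e1 hv
      omega
  by_cases hb : Anc par b u
  · rcases (t.dep_le u).lt_or_eq with hlt | heq
    · exact Or.inl ⟨_, hlt.le, hin u hb hlt⟩
    · have huc : u ≠ c := fun e => by
        rw [e, h.dep_root] at heq
        omega
      refine Or.inr (Or.inr ⟨huc, Or.inl ?_⟩)
      have hd : dep (par u) = h₁ - 1 := by rw [h.dep_par_eq, heq]
      rcases Nat.eq_zero_or_pos (h₁ - 1) with h0 | h1
      · rw [h0]
        exact hroot0 _ (by omega)
      · rw [← hd]
        exact hin _ (h.anc_chain hb (Anc.par_self par u) (by rw [t.dep_b]; omega)) (by omega)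
  · rcases (t.dep_le_of_not_anc u hb).lt_or_eq with hlt | heq
    · exact Or.inr (Or.inl ⟨_, hlt.le, hout u hb hlt⟩)
    · have huc : u ≠ c := fun e => by
        rw [e, h.dep_root] at heq
        omega
      refine Or.inr (Or.inr ⟨huc, Or.inr ?_⟩)
      have hd : dep (par u) = h₂ - 1 := by rw [h.dep_par_eq, heq]
      rw [← hd]
      exact hout _ (fun ha => hb (ha.trans (Anc.par_self par u))) (by omega)

end TwoChains

end Levels

section ExistsChains

variable {V : Type*} [Fintype V] {G : SimpleGraph V} {c : V} {par : V → V} {dep : V → ℕ}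

lemma IsRooted.sum_chi (h : IsRooted G c par dep) (u : V) : ∑ v, chi par v u = dep u + 1 := by
  induction hk : dep u generalizing u with
  | zero =>
    rw [h.dep_eq_zero.mp hk, ← Finset.add_sum_erase _ _ (Finset.mem_univ c), h.chi_root_left,
      Finset.sum_eq_zero fun v hv => h.chi_root_right (Finset.ne_of_mem_erase hv)]
    norm_num
  | succ k ih =>
    have hu : u ≠ c := fun hc => by
      rw [hc, h.dep_root] at hk
      omega
    rw [Finset.sum_congr rfl fun v _ => h.chi_par hu v, Finset.sum_add_distrib,
      ih (par u) (by rw [h.dep_par_eq, hk]; rfl)]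
    simp

/-- Distances between vertices whose only common ancestor is the root. -/
lemma IsRooted.dist_eq_add (h : IsRooted G c par dep) {x y : V}
    (hxy : ∀ v, Anc par v x → Anc par v y → v = c) : G.dist x y = dep x + dep y := by
  have h1 : ∀ v, (chi par v x - chi par v y) ^ 2 =
      chi par v x + chi par v y - 2 * if v = c then 1 else 0 := by
    intro v
    by_cases hv : v = c
    · subst hv
      rw [h.chi_root_left, h.chi_root_left]
      norm_num
    · unfold chi
      by_cases ex : Anc par v x <;> by_cases ey : Anc par v y
      · exact absurd (hxy v ex ey) hv
      all_goals simp [ex, ey, hv]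
  have h2 : (G.dist x y : ℚ) = dep x + dep y := by
    rw [h.dist_eq, Finset.sum_congr rfl fun v _ => h1 v, Finset.sum_sub_distrib,
      Finset.sum_add_distrib, h.sum_chi, h.sum_chi, ← Finset.mul_sum]
    simp only [Finset.sum_ite_eq', Finset.mem_univ, if_true]
    ring
  exact_mod_cast h2

lemma IsRooted.exists_twoChains (h : IsRooted G c par dep)
    (hmin : ∀ w, joinTime G c ≤ joinTime G w) (hcard : 3 ≤ Fintype.card V)
    (hdiam : gdiam G + 1 ≤ Fintype.card V) :
    ∃ (b : V) (X Y : ℕ → V) (h₁ h₂ : ℕ),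
      TwoChains c par dep b X Y h₁ h₂ (Fintype.card V / 2)
        (Fintype.card V - 1 - Fintype.card V / 2) ∧
      h₁ + h₂ ≤ gdiam G ∧ (∀ i, i < h₁ → par (X (i + 1)) = X i) ∧
      (∀ i, i < h₂ → par (Y (i + 1)) = Y i) := by
  have hsz : ∀ v, v ≠ c → 2 * sz par v ≤ Fintype.card V := fun v hv => h.two_mul_sz_le hmin hv
  have hcne : ∀ v, dep v ≠ 0 → v ≠ c := fun v hv e => hv (by rw [e, h.dep_root])
  obtain ⟨x, -, hx⟩ := Finset.exists_max_image univ dep ⟨c, Finset.mem_univ c⟩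
  have hx1 : 1 ≤ dep x := by
    have : Nontrivial V := Fintype.one_lt_card_iff_nontrivial.mp (by omega)
    obtain ⟨v, hv⟩ := exists_ne c
    exact (h.dep_pos hv).trans_le (hx v (Finset.mem_univ v))
  obtain ⟨b, hb⟩ : ∃ b, b = par^[dep x - 1] x := ⟨_, rfl⟩
  have hdb : dep b = 1 := by
    rw [hb, h.dep_iterate]
    omega
  have hbx : Anc par b x := ⟨_, hb.symm⟩
  have hbc : ¬ Anc par b c := fun ha => by
    have := h.anc_dep_le ha
    rw [h.dep_root] at this
    omega
  obtain ⟨y, hy, hymax⟩ := Finset.exists_max_image (univ.filter fun v => ¬ Anc par b v) dep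
    ⟨c, by simpa using hbc⟩
  simp only [Finset.mem_filter, Finset.mem_univ, true_and] at hy hymax
  have hy1 : 1 ≤ dep y := by
    by_contra h0
    have h1 : ∀ v, ¬ Anc par b v → v = c := fun v hv =>
      h.dep_eq_zero.mp (by have := hymax v hv; omega)
    have h2 : Fintype.card V ≤ sz par b + 1 := by
      have : (univ : Finset V) ⊆ insert c (univ.filter fun u => Anc par b u) := by
        intro v _
        simp only [Finset.mem_insert, Finset.mem_filter, Finset.mem_univ, true_and]
        by_contra hv
        push Not at hv
        exact hv.1 (h1 v hv.2)
      exact (Finset.card_le_card this).trans (Finset.card_insert_le _ _)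
    have h3 := hsz b (hcne b (by omega))
    omega
  have hdist : dep x + dep y ≤ gdiam G := by
    rw [← h.dist_eq_add (x := x) (y := y)]
    · exact Finset.le_sup (f := fun p : V × V => G.dist p.1 p.2) (Finset.mem_univ (x, y))
    · intro v hvx hvy
      by_contra hv
      have h1 := h.dep_pos hv
      exact hy ((h.anc_chain hbx hvx (by omega)).trans hvy)
  have hchain : ∀ z : V, ∀ i, i < dep z → par (par^[dep z - (i + 1)] z) = par^[dep z - i] z := by
    intro z i hi
    rw [← Function.iterate_succ_apply' par]
    congr 2
    omega
  have hxy := hx y (Finset.mem_univ y)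
  have hxM : dep x ≤ Fintype.card V / 2 := by
    have h1 := h.sum_sz_add_card_le (j := dep x) ({x} : Finset V)
      ((Finset.Ico 1 (dep x)).image fun i => par^[dep x - i] x)
      (univ.filter fun u => Anc par b u) (by simp)
      (fun v hv => by
        obtain ⟨i, hi, rfl⟩ := Finset.mem_image.mp hv
        rw [Finset.mem_Ico] at hi
        rw [h.dep_iterate]
        omega)
      (fun v hv => by
        obtain ⟨i, hi, rfl⟩ := Finset.mem_image.mp hv
        rw [Finset.mem_Ico] at hi
        simp only [Finset.mem_filter, Finset.mem_univ, true_and]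
        exact h.anc_chain hbx ⟨_, rfl⟩ (by rw [h.dep_iterate]; omega))
      (fun v hv u hu => by
        rw [Finset.mem_singleton] at hv
        subst hv
        simpa using hbx.trans hu)
    rw [Finset.card_image_of_injOn, Nat.card_Ico, Finset.sum_singleton] at h1
    · have h2 := hsz b (hcne b (by omega))
      have h3 := sz_pos par x
      have h4 : (univ.filter fun u => Anc par b u).card = sz par b := rfl
      omega
    · intro i hi k hk hik
      have e := congrArg dep hik
      simp only [Finset.coe_Ico, Set.mem_Ico, h.dep_iterate] at hi hk e
      omega
  refine ⟨b, fun i => par^[dep x - i] x, fun i => par^[dep y - i] y, dep x, dep y, ?_, hdist,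
    hchain x, hchain y⟩
  exact
    { dep_b := hdb
      dep_X := fun i hi => by
        rw [h.dep_iterate]
        omega
      anc_X := fun i h1 hi => h.anc_chain hbx ⟨_, rfl⟩ (by rw [h.dep_iterate]; omega)
      dep_Y := fun i hi => by
        rw [h.dep_iterate]
        omega
      not_anc_Y := fun i _ ha => hy (ha.trans ⟨_, rfl⟩)
      dep_le := fun v => hx v (Finset.mem_univ v)
      dep_le_of_not_anc := hymax
      one_le := hy1
      le := hxy
      sz_le := fun v hv => by
        have := hsz v hv
        omega
      card_eq := by omega
      M_le := by omega
      h₁_le := hxM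
      h₂_le := by omega }

end ExistsChains

section DoubleBroom

/-- The parent map of the double broom rooted at the vertex `h₁` of its spine. -/
def broomPar (h₁ h₂ a i : ℕ) : ℕ :=
  if i < h₁ then i + 1 else if i = h₁ then i else if i ≤ h₁ + h₂ then i - 1
  else if i ≤ h₁ + h₂ + a then 1 else h₁ + h₂ - 1

/-- The depth in the double broom rooted at the vertex `h₁` of its spine. -/
def broomDep (h₁ h₂ a i : ℕ) : ℕ :=
  if i ≤ h₁ then h₁ - i else if i ≤ h₁ + h₂ then i - h₁
  else if i ≤ h₁ + h₂ + a then h₁ else h₂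

variable {n h₁ h₂ a : ℕ}

lemma broomPar_lt (ha : a + (h₁ + h₂) + 1 ≤ n) (h1 : 1 ≤ h₁) (h2 : 1 ≤ h₂) (i : Fin n) :
    broomPar h₁ h₂ a i < n := by
  have := i.2
  unfold broomPar
  split_ifs <;> omega

/-- `broomPar` as a map on vertices. -/
def broomParent (ha : a + (h₁ + h₂) + 1 ≤ n) (h1 : 1 ≤ h₁) (h2 : 1 ≤ h₂) (i : Fin n) : Fin n :=
  ⟨broomPar h₁ h₂ a i, broomPar_lt ha h1 h2 i⟩

lemma doubleBroom_isRooted (ha : a + (h₁ + h₂) + 1 ≤ n) (h1 : 1 ≤ h₁) (h2 : 1 ≤ h₂) :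
    IsRooted (doubleBroom n (h₁ + h₂) a) ⟨h₁, by omega⟩ (broomParent ha h1 h2)
      (fun i => broomDep h₁ h₂ a i) where
  par_root := by
    simp [broomParent, broomPar]
  dep_root := by
    simp [broomDep]
  dep_par := by
    rintro ⟨i, hi⟩ hne
    have hne' : i ≠ h₁ := fun e => hne (Fin.ext e)
    simp only [broomParent, broomDep, broomPar]
    split_ifs <;> omega
  adj_iff := by
    rintro ⟨i, hi⟩ ⟨j, hj⟩
    simp only [doubleBroom, SimpleGraph.fromRel_adj, broomParent, broomPar, ne_eq, Fin.mk.injEq]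
    constructor
    · rintro ⟨hij, (h | h | h) | (h | h | h)⟩ <;> split_ifs <;> omega
    · rintro (⟨hij, h⟩ | ⟨hij, h⟩) <;> split_ifs at h <;> omega

lemma card_filter_val_mem (S : Finset ℕ) (hS : ∀ x ∈ S, x < n) :
    (univ.filter fun i : Fin n => i.val ∈ S).card = S.card := by
  rw [← Finset.card_image_of_injective _ Fin.val_injective]
  congr 1
  ext x
  simp only [Finset.mem_image, Finset.mem_filter, Finset.mem_univ, true_and]
  constructor
  · rintro ⟨i, hi, rfl⟩
    exact hi
  · intro hx
    exact ⟨⟨x, hS x hx⟩, hx, rfl⟩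

lemma Anc.of_invariant {V : Type*} {par : V → V} {P : V → Prop} (hP : ∀ v, ¬ P v → ¬ P (par v))
    {v u : V} (ha : Anc par v u) (hv : P v) : P u := by
  obtain ⟨k, rfl⟩ := ha
  induction k generalizing u with
  | zero => exact hv
  | succ k ih =>
    by_contra hu
    exact hP u hu (ih hv)

lemma broom_two_mul_sz_le (ha : a + (h₁ + h₂) + 1 ≤ n) (h1 : 1 ≤ h₁) (h2 : 1 ≤ h₂)
    (hl : 2 * (h₁ + a) ≤ n) (hr : 2 * (n - 1 - (h₁ + a)) ≤ n) (v : Fin n) (hv : v.val ≠ h₁) :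
    2 * sz (broomParent ha h1 h2) v ≤ n := by
  by_cases hside : v.val ∈ Finset.range h₁ ∪ Finset.Ioc (h₁ + h₂) (h₁ + h₂ + a)
  · have e1 : sz (broomParent ha h1 h2) v ≤
        (univ.filter fun i : Fin n =>
          i.val ∈ Finset.range h₁ ∪ Finset.Ioc (h₁ + h₂) (h₁ + h₂ + a)).card := by
      refine Finset.card_le_card fun u hu => ?_
      simp only [Finset.mem_filter, Finset.mem_univ, true_and] at hu ⊢
      refine Anc.of_invariant (P := fun i : Fin n =>
        i.val ∈ Finset.range h₁ ∪ Finset.Ioc (h₁ + h₂) (h₁ + h₂ + a)) (fun w hw => ?_) hu hside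
      simp only [broomParent, broomPar, Finset.mem_union, Finset.mem_range, Finset.mem_Ioc] at hw ⊢
      split_ifs <;> omega
    rw [card_filter_val_mem _ (by
      intro x hx
      simp only [Finset.mem_union, Finset.mem_range, Finset.mem_Ioc] at hx
      omega)] at e1
    have e2 := Finset.card_union_le (Finset.range h₁) (Finset.Ioc (h₁ + h₂) (h₁ + h₂ + a))
    rw [Finset.card_range, Nat.card_Ioc] at e2
    omega
  · have e1 : sz (broomParent ha h1 h2) v ≤
        (univ.filter fun i : Fin n =>
          i.val ∈ Finset.Ioc h₁ (h₁ + h₂) ∪ Finset.Ico (h₁ + h₂ + a + 1) n).card := by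
      refine Finset.card_le_card fun u hu => ?_
      simp only [Finset.mem_filter, Finset.mem_univ, true_and] at hu ⊢
      refine Anc.of_invariant (P := fun i : Fin n =>
        i.val ∈ Finset.Ioc h₁ (h₁ + h₂) ∪ Finset.Ico (h₁ + h₂ + a + 1) n)
        (fun w hw => ?_) hu ?_
      · have := w.2
        simp only [broomParent, broomPar, Finset.mem_union, Finset.mem_Ico, Finset.mem_Ioc] at hw ⊢
        split_ifs <;> omega
      · have := v.2
        simp only [Finset.mem_union, Finset.mem_range, Finset.mem_Ico, Finset.mem_Ioc] at hside ⊢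
        omega
    rw [card_filter_val_mem _ (by
      intro x hx
      simp only [Finset.mem_union, Finset.mem_Ico, Finset.mem_Ioc] at hx
      omega)] at e1
    have e2 := Finset.card_union_le (Finset.Ioc h₁ (h₁ + h₂)) (Finset.Ico (h₁ + h₂ + a + 1) n)
    rw [Nat.card_Ico, Nat.card_Ioc] at e2
    omega

/-- Subtree sizes in the double broom rooted at the vertex `h₁` of its spine. -/
def broomSz (n h₁ h₂ a i : ℕ) : ℕ :=
  if 1 ≤ i ∧ i < h₁ then i + 1 + a else if h₁ < i ∧ i < h₁ + h₂ then n - a - i else 1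

lemma broomSz_le_left (ha : a + (h₁ + h₂) + 1 ≤ n) (h1 : 1 ≤ h₁) (h2 : 1 ≤ h₂) (i : ℕ) (hi1 : 1 ≤ i)
    (hi : i < h₁) : i + 1 + a ≤ sz (broomParent ha h1 h2) ⟨i, by omega⟩ := by
  induction i, hi1 using Nat.le_induction with
  | base =>
    have e1 : (univ.filter fun i : Fin n =>
        i.val ∈ Finset.range 2 ∪ Finset.Ioc (h₁ + h₂) (h₁ + h₂ + a)).card ≤
        sz (broomParent ha h1 h2) ⟨1, by omega⟩ := by
      refine Finset.card_le_card fun u hu => ?_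
      simp only [Finset.mem_filter, Finset.mem_univ, true_and, Finset.mem_union, Finset.mem_range,
        Finset.mem_Ioc] at hu ⊢
      by_cases hu1 : u.val = 1
      · exact ⟨0, Fin.ext hu1⟩
      · refine ⟨1, Fin.ext ?_⟩
        simp only [Function.iterate_one, broomParent, broomPar]
        split_ifs <;> omega
    rw [card_filter_val_mem _ (by
      intro x hx
      simp only [Finset.mem_union, Finset.mem_range, Finset.mem_Ioc] at hx
      omega), Finset.card_union_of_disjoint, Finset.card_range, Nat.card_Ioc] at e1
    · omega
    · refine Finset.disjoint_left.mpr fun x hx hx' => ?_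
      simp only [Finset.mem_range, Finset.mem_Ioc] at hx hx'
      omega
  | succ i hi1 ih =>
    have e1 := ih (by omega)
    have e2 := (doubleBroom_isRooted ha h1 h2).sz_lt_sz_par (v := ⟨i, by omega⟩)
      (fun e => by
        have := congrArg Fin.val e
        simp only at this
        omega)
    have e3 : broomParent ha h1 h2 ⟨i, by omega⟩ = ⟨i + 1, by omega⟩ := by
      refine Fin.ext ?_
      simp only [broomParent, broomPar]
      split_ifs <;> omega
    rw [e3] at e2
    omega

lemma broomSz_le_right (ha : a + (h₁ + h₂) + 1 ≤ n) (h1 : 1 ≤ h₁) (h2 : 1 ≤ h₂) (k : ℕ) (hk : 1 ≤ k)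
    (hk2 : k < h₂) : n - a - (h₁ + h₂ - k) ≤
      sz (broomParent ha h1 h2) ⟨h₁ + h₂ - k, by omega⟩ := by
  induction k, hk using Nat.le_induction with
  | base =>
    have e1 : (univ.filter fun i : Fin n =>
        i.val ∈ Finset.Icc (h₁ + h₂ - 1) (h₁ + h₂) ∪ Finset.Ico (h₁ + h₂ + a + 1) n).card ≤
        sz (broomParent ha h1 h2) ⟨h₁ + h₂ - 1, by omega⟩ := by
      refine Finset.card_le_card fun u hu => ?_
      simp only [Finset.mem_filter, Finset.mem_univ, true_and, Finset.mem_union, Finset.mem_Icc,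
        Finset.mem_Ico] at hu ⊢
      by_cases hu1 : u.val = h₁ + h₂ - 1
      · exact ⟨0, Fin.ext hu1⟩
      · refine ⟨1, Fin.ext ?_⟩
        simp only [Function.iterate_one, broomParent, broomPar]
        split_ifs <;> omega
    rw [card_filter_val_mem _ (by
      intro x hx
      simp only [Finset.mem_union, Finset.mem_Icc, Finset.mem_Ico] at hx
      omega), Finset.card_union_of_disjoint, Nat.card_Icc, Nat.card_Ico] at e1
    · omega
    · refine Finset.disjoint_left.mpr fun x hx hx' => ?_
      simp only [Finset.mem_Icc, Finset.mem_Ico] at hx hx'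
      omega
  | succ k hk ih =>
    have e1 := ih (by omega)
    have e2 := (doubleBroom_isRooted ha h1 h2).sz_lt_sz_par (v := ⟨h₁ + h₂ - k, by omega⟩)
      (fun e => by
        have := congrArg Fin.val e
        simp only at this
        omega)
    have e3 : broomParent ha h1 h2 ⟨h₁ + h₂ - k, by omega⟩ = ⟨h₁ + h₂ - (k + 1), by omega⟩ := by
      refine Fin.ext ?_
      simp only [broomParent, broomPar]
      split_ifs <;> omega
    rw [e3] at e2
    omega

lemma sum_levelBound (ha : a + (h₁ + h₂) + 1 ≤ n) (h1 : 1 ≤ h₁) (h2 : 1 ≤ h₂) (hle : h₂ ≤ h₁) :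
    ∑ j ∈ Finset.Icc 1 h₁, levelBound h₁ h₂ (h₁ + a) (n - 1 - (h₁ + a)) j =
      ∑ v ∈ univ.erase (⟨h₁, by omega⟩ : Fin n), (2 * (broomSz n h₁ h₂ a v : ℚ) - 1) ^ 2 := by
  obtain ⟨f, hf⟩ : ∃ f : ℕ → ℚ, f = fun i => (2 * (broomSz n h₁ h₂ a i : ℚ) - 1) ^ 2 := ⟨_, rfl⟩
  have hR : ∑ v ∈ univ.erase (⟨h₁, by omega⟩ : Fin n), (2 * (broomSz n h₁ h₂ a v : ℚ) - 1) ^ 2 =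
      ∑ i ∈ Finset.Ico 0 n, f i - f h₁ := by
    have e := Finset.add_sum_erase univ (fun v : Fin n => f v) (Finset.mem_univ ⟨h₁, by omega⟩)
    rw [Fin.sum_univ_eq_sum_range, Finset.range_eq_Ico] at e
    rw [← e, hf]
    ring
  have h0 : f 0 = 1 := by
    rw [hf]
    simp only [broomSz]
    rw [if_neg (by omega), if_neg (by omega)]
    norm_num
  have hd : f (h₁ + h₂) = 1 := by
    rw [hf]
    simp only [broomSz]
    rw [if_neg (by omega), if_neg (by omega)]
    norm_num
  have hleaf : ∑ i ∈ Finset.Ico (h₁ + h₂ + 1) n, f i = (n : ℚ) - (h₁ + h₂ + 1) := by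
    rw [Finset.sum_congr rfl (g := fun _ => (1 : ℚ)), Finset.sum_const, Nat.card_Ico, nsmul_one,
      Nat.cast_sub (by omega)]
    · push_cast
      ring
    · intro i hi
      rw [Finset.mem_Ico] at hi
      rw [hf]
      simp only [broomSz]
      rw [if_neg (by omega), if_neg (by omega)]
      norm_num
  have hleft : ∑ i ∈ Finset.Ico 1 h₁, f i =
      ∑ j ∈ Finset.Ico 1 h₁, (2 * ((h₁ + a + 1 - j : ℕ) : ℚ) - 1) ^ 2 := by
    refine Finset.sum_nbij' (fun i => h₁ - i) (fun i => h₁ - i) ?_ ?_ ?_ ?_ ?_ <;>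
      intro i hi <;> rw [Finset.mem_Ico] at hi
    · rw [Finset.mem_Ico]
      omega
    · rw [Finset.mem_Ico]
      omega
    · omega
    · omega
    · rw [hf]
      simp only [broomSz]
      rw [if_pos (by omega)]
      congr 4
      omega
  have hright : ∑ i ∈ Finset.Ico (h₁ + 1) (h₁ + h₂), f i =
      ∑ j ∈ Finset.Ico 1 h₂, (2 * ((n - 1 - (h₁ + a) + 1 - j : ℕ) : ℚ) - 1) ^ 2 := by
    refine Finset.sum_nbij' (fun i => i - h₁) (fun i => i + h₁) ?_ ?_ ?_ ?_ ?_ <;>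
      intro i hi <;> rw [Finset.mem_Ico] at hi
    · rw [Finset.mem_Ico]
      omega
    · rw [Finset.mem_Ico]
      omega
    · omega
    · omega
    · rw [hf]
      simp only [broomSz]
      rw [if_neg (by omega), if_pos (by omega)]
      congr 4
      omega
  have hL : ∑ j ∈ Finset.Icc 1 h₁, levelBound h₁ h₂ (h₁ + a) (n - 1 - (h₁ + a)) j =
      ∑ j ∈ Finset.Ico 1 h₁, (2 * ((h₁ + a + 1 - j : ℕ) : ℚ) - 1) ^ 2 +
      ∑ j ∈ Finset.Ico 1 h₂, (2 * ((n - 1 - (h₁ + a) + 1 - j : ℕ) : ℚ) - 1) ^ 2 +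
      ((h₁ + a + 1 - h₁ : ℕ) : ℚ) + ((n - 1 - (h₁ + a) + 1 - h₂ : ℕ) : ℚ) := by
    unfold levelBound
    rw [Finset.sum_add_distrib, Finset.sum_add_distrib, Finset.sum_add_distrib,
      ← Finset.sum_filter, ← Finset.sum_filter, Finset.sum_ite_eq', Finset.sum_ite_eq',
      if_pos (Finset.mem_Icc.mpr ⟨h1, le_rfl⟩), if_pos (Finset.mem_Icc.mpr ⟨h2, hle⟩)]
    have f1 : (Finset.Icc 1 h₁).filter (fun j => j < h₁) = Finset.Ico 1 h₁ := by
      ext j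
      simp only [Finset.mem_filter, Finset.mem_Icc, Finset.mem_Ico]
      omega
    have f2 : (Finset.Icc 1 h₁).filter (fun j => j < h₂) = Finset.Ico 1 h₂ := by
      ext j
      simp only [Finset.mem_filter, Finset.mem_Icc, Finset.mem_Ico]
      omega
    rw [f1, f2]
  have hc : ((h₁ + a + 1 - h₁ : ℕ) : ℚ) + ((n - 1 - (h₁ + a) + 1 - h₂ : ℕ) : ℚ) =
      (n : ℚ) - (h₁ + h₂ + 1) + 2 := by
    have : (h₁ + a + 1 - h₁) + (n - 1 - (h₁ + a) + 1 - h₂) + (h₁ + h₂ + 1) = n + 2 := by omega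
    have := congrArg (Nat.cast (R := ℚ)) this
    push_cast at this ⊢
    linarith
  have e1 := Finset.sum_Ico_consecutive f (Nat.zero_le 1) (show 1 ≤ n by omega)
  have e2 := Finset.sum_Ico_consecutive f h1 (show h₁ ≤ n by omega)
  have e3 := Finset.sum_Ico_consecutive f (Nat.le_succ h₁) (show h₁ + 1 ≤ n by omega)
  have e4 := Finset.sum_Ico_consecutive f (show h₁ + 1 ≤ h₁ + h₂ by omega)
    (show h₁ + h₂ ≤ n by omega)
  have e5 := Finset.sum_Ico_consecutive f (Nat.le_succ (h₁ + h₂)) (show h₁ + h₂ + 1 ≤ n by omega)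
  simp only [Nat.succ_eq_add_one, Nat.Ico_succ_singleton, Finset.sum_singleton] at e1 e3 e5
  have e6 : ∑ i ∈ Finset.Ico 0 1, f i = f 0 := by simp
  rw [hR, hL]
  linarith

/-- Lower bound for `Jmin` of a double broom balanced around the vertex `h₁` of its spine. -/
lemma sum_levelBound_le_Jmin (ha : a + (h₁ + h₂) + 1 ≤ n) (h1 : 1 ≤ h₁) (h2 : 1 ≤ h₂)
    (hle : h₂ ≤ h₁) (hl : 2 * (h₁ + a) ≤ n) (hr : 2 * (n - 1 - (h₁ + a)) ≤ n) :
    ∑ j ∈ Finset.Icc 1 h₁, levelBound h₁ h₂ (h₁ + a) (n - 1 - (h₁ + a)) j ≤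
      Jmin (doubleBroom n (h₁ + h₂) a) := by
  rw [sum_levelBound ha h1 h2 hle]
  refine le_trans (le_of_eq ?_) ((doubleBroom_isRooted ha h1 h2).sum_le_Jmin
    (fun v => broomSz n h₁ h₂ a v) (fun v => ?_) (fun v hv => ?_) (fun v hv => ?_))
  · exact Finset.sum_congr (by ext; simp) fun _ _ => rfl
  · have := v.2
    simp only [broomSz]
    split_ifs <;> omega
  · obtain ⟨i, hi⟩ := v
    simp only [broomSz]
    split_ifs with c1 c2
    · exact broomSz_le_left ha h1 h2 i c1.1 c1.2
    · have := broomSz_le_right ha h1 h2 (h₁ + h₂ - i) (by omega) (by omega)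
      have e : h₁ + h₂ - (h₁ + h₂ - i) = i := by omega
      simpa only [e] using this
    · exact sz_pos _ _
  · rw [Fintype.card_fin]
    exact broom_two_mul_sz_le ha h1 h2 hl hr v fun e => hv (Fin.ext e)

end DoubleBroom

section Recognition

variable {V : Type*} {G : SimpleGraph V}

lemma exists_enumeration [Nonempty V] (S : Finset V) :
    ∃ q : ℕ → V, (∀ i < S.card, q i ∈ S) ∧ ∀ i < S.card, ∀ j < S.card, q i = q j → i = j := by
  refine ⟨fun i => if h : i < S.card then S.equivFin.symm ⟨i, h⟩ else Classical.arbitrary V,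
    fun i hi => ?_, fun i hi j hj hij => ?_⟩
  · simp only [dif_pos hi]
    exact (S.equivFin.symm ⟨i, hi⟩).2
  · simp only [dif_pos hi, dif_pos hj] at hij
    exact congrArg Fin.val (S.equivFin.symm.injective (Subtype.ext hij))

lemma nonempty_iso_of_le_comap (hT : G.IsTree) {W : Type*} {H : SimpleGraph W} (hH : H.Connected)
    (e : W ≃ V) (hle : H ≤ G.comap e) : Nonempty (G ≃g H) := by
  have hT' : (G.comap e).IsTree := (SimpleGraph.Iso.comap e G).isTree_iff.mpr hT
  have he : H = G.comap e := (SimpleGraph.isTree_iff_minimal_connected.mp hT').eq_of_le hH hle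
  rw [he]
  exact ⟨(SimpleGraph.Iso.comap e G).symm⟩

/-- A tree with a path such that every other vertex is adjacent to the second or to the
penultimate vertex of this path is a double broom. -/
lemma exists_iso_doubleBroom [Fintype V] (hT : G.IsTree) {d : ℕ} (hd : 2 ≤ d) (p : ℕ → V)
    (hp : ∀ i ≤ d, ∀ j ≤ d, p i = p j → i = j) (hadj : ∀ i < d, G.Adj (p i) (p (i + 1)))
    (hrest : ∀ v, (∃ i ≤ d, v = p i) ∨ G.Adj (p 1) v ∨ G.Adj (p (d - 1)) v) :
    ∃ a, a + d + 1 ≤ Fintype.card V ∧ Nonempty (G ≃g doubleBroom (Fintype.card V) d a) := by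
  have : Nonempty V := ⟨p 0⟩
  obtain ⟨P, hP⟩ : ∃ P : Finset V, P = (Finset.range (d + 1)).image p := ⟨_, rfl⟩
  have hPmem : ∀ v, v ∈ P ↔ ∃ i ≤ d, v = p i := by
    intro v
    simp only [hP, Finset.mem_image, Finset.mem_range, Nat.lt_succ_iff, eq_comm]
  have hPcard : P.card = d + 1 := by
    rw [hP, Finset.card_image_of_injOn, Finset.card_range]
    intro i hi j hj hij
    simp only [Finset.coe_range, Set.mem_Iio] at hi hj
    exact hp i (by omega) j (by omega) hij
  obtain ⟨q, hq, hqi⟩ := exists_enumeration (Pᶜ.filter fun v => G.Adj (p 1) v)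
  obtain ⟨r, hr, hri⟩ := exists_enumeration (Pᶜ.filter fun v => ¬ G.Adj (p 1) v)
  have hsum := Finset.card_filter_add_card_filter_not (s := Pᶜ) (fun v => G.Adj (p 1) v)
  have hcompl := Finset.card_add_card_compl P
  generalize hA : (Pᶜ.filter fun v => G.Adj (p 1) v).card = a at hq hqi hsum
  generalize hB : (Pᶜ.filter fun v => ¬ G.Adj (p 1) v).card = b at hr hri hsum
  simp only [Finset.mem_filter, Finset.mem_compl, hPmem] at hq hr
  have hpq : ∀ i ≤ d, ∀ j < a, p i ≠ q j := fun i hi j hj e => (hq j hj).1 ⟨i, hi, e.symm⟩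
  have hpr : ∀ i ≤ d, ∀ j < b, p i ≠ r j := fun i hi j hj e => (hr j hj).1 ⟨i, hi, e.symm⟩
  have hqr : ∀ i < a, ∀ j < b, q i ≠ r j := fun i hi j hj e => (hr j hj).2 (e ▸ (hq i hi).2)
  have hr' : ∀ j < b, G.Adj (p (d - 1)) (r j) := fun j hj =>
    ((hrest (r j)).resolve_left (hr j hj).1).resolve_left (hr j hj).2
  obtain ⟨f, hf⟩ : ∃ f : Fin (Fintype.card V) → V, f = fun i : Fin (Fintype.card V) =>
    if i.val ≤ d then p i else if i.val ≤ d + a then q (i - d - 1) else r (i - d - a - 1) :=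
    ⟨_, rfl⟩
  have hfi : Function.Injective f := by
    rintro ⟨i, hi⟩ ⟨j, hj⟩ hij
    refine Fin.ext ?_
    simp only [hf] at hij
    split_ifs at hij
    · exact hp _ (by assumption) _ (by assumption) hij
    · exact absurd hij (hpq _ (by omega) _ (by omega))
    · exact absurd hij (hpr _ (by omega) _ (by omega))
    · exact absurd hij.symm (hpq _ (by omega) _ (by omega))
    · have := hqi _ (by omega) _ (by omega) hij
      simp only
      omega
    · exact absurd hij (hqr _ (by omega) _ (by omega))
    · exact absurd hij.symm (hpr _ (by omega) _ (by omega))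
    · exact absurd hij.symm (hqr _ (by omega) _ (by omega))
    · have := hri _ (by omega) _ (by omega) hij
      simp only
      omega
  have hfb : Function.Bijective f :=
    (Fintype.bijective_iff_injective_and_card f).mpr ⟨hfi, Fintype.card_fin _⟩
  have hconn : (doubleBroom (Fintype.card V) d a).Connected := by
    obtain ⟨k, rfl⟩ : ∃ k, d = 1 + k := ⟨d - 1, by omega⟩
    exact (doubleBroom_isRooted (by omega) le_rfl (by omega)).connected
  have key : ∀ i j : Fin (Fintype.card V), (i.val + 1 = j.val ∧ j.val ≤ d) ∨
      (i.val = 1 ∧ d < j.val ∧ j.val ≤ d + a) ∨ (i.val = d - 1 ∧ d + a < j.val) →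
      G.Adj (f i) (f j) := by
    rintro ⟨i, hi⟩ ⟨j, hj⟩ (⟨rfl, h⟩ | ⟨rfl, h, h'⟩ | ⟨rfl, h⟩) <;>
      simp only [hf] at h ⊢
    · rw [if_pos (by omega), if_pos h]
      exact hadj i (by omega)
    · simp only at h'
      rw [if_pos (by omega), if_neg (by omega), if_pos h']
      exact (hq _ (by omega)).2
    · rw [if_pos (by omega), if_neg (by omega), if_neg (by omega)]
      exact hr' _ (by omega)
  refine ⟨a, by omega, nonempty_iso_of_le_comap hT hconn (Equiv.ofBijective f hfb) ?_⟩
  intro i j hij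
  rw [SimpleGraph.comap_adj, Equiv.ofBijective_apply, Equiv.ofBijective_apply]
  rw [doubleBroom, SimpleGraph.fromRel_adj] at hij
  exact hij.2.elim (key i j) fun h => (key j i h).symm

lemma TwoChains.exists_iso_doubleBroom [Fintype V] {c : V} {par : V → V} {dep : V → ℕ} {b : V}
    {X Y : ℕ → V} {h₁ h₂ M₁ M₂ : ℕ} (t : TwoChains c par dep b X Y h₁ h₂ M₁ M₂)
    (h : IsRooted G c par dep) (hT : G.IsTree) (hX : ∀ i < h₁, par (X (i + 1)) = X i)
    (hY : ∀ i < h₂, par (Y (i + 1)) = Y i)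
    (he : joinTime G c = ∑ j ∈ Finset.Icc 1 h₁, levelBound h₁ h₂ M₁ M₂ j) :
    ∃ a, a + (h₁ + h₂) + 1 ≤ Fintype.card V ∧
      Nonempty (G ≃g doubleBroom (Fintype.card V) (h₁ + h₂) a) := by
  have hle := t.le
  have h2 := t.one_le
  have hX0 : X 0 = c := h.dep_eq_zero.mp (t.dep_X 0 (Nat.zero_le _))
  have hY0 : Y 0 = c := h.dep_eq_zero.mp (t.dep_Y 0 (Nat.zero_le _))
  have hXc : ∀ i, i < h₁ → X (i + 1) ≠ c := fun i hi e => by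
    have := t.dep_X (i + 1) hi
    rw [e, h.dep_root] at this
    omega
  have hYc : ∀ i, i < h₂ → Y (i + 1) ≠ c := fun i hi e => by
    have := t.dep_Y (i + 1) hi
    rw [e, h.dep_root] at this
    omega
  have hXY : ∀ i j, 1 ≤ i → i ≤ h₁ → j ≤ h₂ → X i ≠ Y j := fun i j h1 hi hj e =>
    t.not_anc_Y j hj (e ▸ t.anc_X i h1 hi)
  obtain ⟨p, hpX, hpY⟩ : ∃ p : ℕ → V, (∀ i ≤ h₁, p i = X (h₁ - i)) ∧
      ∀ i, h₁ ≤ i → p i = Y (i - h₁) := by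
    refine ⟨fun i => if i ≤ h₁ then X (h₁ - i) else Y (i - h₁), fun i hi => if_pos hi,
      fun i hi => ?_⟩
    rcases hi.eq_or_lt with rfl | hi
    · simp [hX0, hY0]
    · exact if_neg (by omega)
  refine _root_.exists_iso_doubleBroom hT (by omega) p (fun i hi j hj hij => ?_) (fun i hi => ?_)
    fun v => ?_
  · rcases le_or_gt h₁ i with h1 | h1 <;> rcases le_or_gt h₁ j with h3 | h3
    · rw [hpY i h1, hpY j h3] at hij
      have := congrArg dep hij
      rw [t.dep_Y _ (by omega), t.dep_Y _ (by omega)] at this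
      omega
    · rw [hpY i h1, hpX j h3.le] at hij
      exact absurd hij.symm (hXY _ _ (by omega) (by omega) (by omega))
    · rw [hpX i h1.le, hpY j h3] at hij
      exact absurd hij (hXY _ _ (by omega) (by omega) (by omega))
    · rw [hpX i h1.le, hpX j h3.le] at hij
      have := congrArg dep hij
      rw [t.dep_X _ (by omega), t.dep_X _ (by omega)] at this
      omega
  · rcases lt_or_ge i h₁ with h1 | h1
    · obtain ⟨k, hk⟩ : ∃ k, h₁ - i = k + 1 := ⟨h₁ - i - 1, by omega⟩
      rw [hpX i h1.le, hpX (i + 1) h1, hk, show h₁ - (i + 1) = k by omega, ← hX k (by omega)]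
      exact h.adj_par (hXc k (by omega))
    · rw [hpY i h1, hpY (i + 1) (by omega), show i + 1 - h₁ = i - h₁ + 1 by omega]
      have := h.adj_par (hYc (i - h₁) (by omega))
      rw [hY _ (by omega)] at this
      exact this.symm
  · rw [hpX 1 (by omega), hpY (h₁ + h₂ - 1) (by omega), show h₁ + h₂ - 1 - h₁ = h₂ - 1 by omega]
    rcases t.structure_of_joinTime_eq h he v with ⟨i, hi, rfl⟩ | ⟨i, hi, rfl⟩ | ⟨hv, hv' | hv'⟩
    · exact Or.inl ⟨h₁ - i, by omega, by rw [hpX _ (by omega), Nat.sub_sub_self hi]⟩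
    · exact Or.inl ⟨h₁ + i, by omega, by rw [hpY _ (by omega), Nat.add_sub_cancel_left]⟩
    · exact Or.inr (Or.inl (hv' ▸ (h.adj_par hv).symm))
    · exact Or.inr (Or.inr (hv' ▸ (h.adj_par hv).symm))

end Recognition

/-- any tree of order `n` and diameter `d` that is not a double broom has
strictly smaller `J_min` than some double broom of order `n` and diameter `d' ≤ d`. -/
theorem to_double_broom (n d : ℕ) (hd2 : 2 ≤ d) (hdn : d ≤ n - 1)
    {V : Type*} [Fintype V] (G : SimpleGraph V)
    (hT : G.IsTree) (hcard : Fintype.card V = n) (hdiam : gdiam G = d)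
    (hnotdb : ∀ d' a : ℕ, 2 ≤ d' → d' ≤ n - 1 → a ≤ n - d' - 1 →
      ¬ Nonempty (G ≃g doubleBroom n d' a)) :
    ∃ d' a : ℕ, 2 ≤ d' ∧ d' ≤ d ∧ a ≤ n - d' - 1 ∧
      Jmin G < Jmin (doubleBroom n d' a) := by
  subst hcard hdiam
  have : Nonempty V := hT.connected.nonempty
  obtain ⟨c, hc⟩ := exists_joinTime_eq_Jmin (G := G)
  obtain ⟨par, h⟩ := exists_isRooted hT c
  obtain ⟨b, X, Y, h₁, h₂, t, hsum, hX, hY⟩ := h.exists_twoChains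
    (fun w => hc ▸ Jmin_le w) (by omega) (by omega)
  have h2 := t.one_le
  have hle := t.le
  have hl₁ := t.h₁_le
  have hl₂ := t.h₂_le
  have ha : h₁ + (Fintype.card V / 2 - h₁) = Fintype.card V / 2 := by omega
  have hJ := sum_levelBound_le_Jmin (n := Fintype.card V) (a := Fintype.card V / 2 - h₁)
    (by omega) (h2.trans hle) h2 hle (by omega) (by omega)
  rw [ha] at hJ
  refine ⟨h₁ + h₂, Fintype.card V / 2 - h₁, by omega, hsum, by omega, ?_⟩
  by_contra hlt
  have hbound := t.joinTime_le h
  obtain ⟨a, hcard, hiso⟩ := t.exists_iso_doubleBroom h hT hX hY (by linarith)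
  exact hnotdb (h₁ + h₂) a (by omega) (by omega) (by omega) hiso
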